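/- Let K be a field of characteristic zero and let V, W be K-vector spaces with dim V = dim W = 2, with Γ = GL(V) × GL(W) acting on U = End(V ⊗ W) by (g,h)·φ = (g⊗h)∘φ∘(g⊗h)⁻¹. Then the Hilbert series F(x) = Σ_{n≥0} dim (K[U]^Γ)ₙ xⁿ equals the rational function (1 − x² − x³ + 2x⁴ + 2x⁵ + 2x⁶ − x⁷ − x⁸ + x¹⁰) / ((1−x)(1−x²)⁴(1−x³)³(1−x⁴)²). -/

import Mathlib

open PowerSeries

open PowerSeries

/-- The space of `Γ`-invariant homogeneous polynomial functions of degree `n` on `U`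
(for the action `act` of `Γ` on `U`): functions `U → K` which are restrictions to the
diagonal of an `n`-multilinear form (over a field of characteristic zero this is exactly
the degree-`n` homogeneous polynomial functions) and which are invariant under `act`.
This is the `n`-th homogeneous component `(K[U]^Γ)ₙ` of the invariant ring. -/
def invariantPolynomials (K : Type) [Field K] {U Γ : Type} [AddCommGroup U] [Module K U]
    (act : Γ → U → U) (n : ℕ) : Submodule K (U → K) where
  carrier := {F | (∃ m : MultilinearMap K (fun _ : Fin n => U) K, ∀ u, F u = m fun _ => u) ∧
    ∀ γ u, F (act γ u) = F u}
  add_mem' := by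
    rintro F G ⟨⟨mF, hF⟩, hFi⟩ ⟨⟨mG, hG⟩, hGi⟩
    refine ⟨⟨mF + mG, fun u => ?_⟩, fun γ u => ?_⟩
    · simp [hF, hG]
    · simp [Pi.add_apply, hFi γ u, hGi γ u]
  zero_mem' := by
    refine ⟨⟨0, fun u => ?_⟩, fun γ u => rfl⟩
    simp
  smul_mem' := by
    rintro c F ⟨⟨mF, hF⟩, hFi⟩
    refine ⟨⟨c • mF, fun u => ?_⟩, fun γ u => ?_⟩
    · simp [hF]
    · simp [Pi.smul_apply, hFi γ u]

/-- The action of `Γ = GL(V) × GL(W)` on `U = End(V ⊗ W)` given by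
`(g,h) · φ = (g⊗h) ∘ φ ∘ (g⊗h)⁻¹`. -/
noncomputable def tensorConjAction (K : Type) [Field K] (V W : Type) [AddCommGroup V]
    [Module K V] [AddCommGroup W] [Module K W] :
    ((V ≃ₗ[K] V) × (W ≃ₗ[K] W)) →
      (TensorProduct K V W →ₗ[K] TensorProduct K V W) →
      (TensorProduct K V W →ₗ[K] TensorProduct K V W) :=
  fun γ φ => (TensorProduct.congr γ.1 γ.2).toLinearMap ∘ₗ φ ∘ₗ
    (TensorProduct.congr γ.1 γ.2).symm.toLinearMap

/-- The factors of the torus denominator with positive weight in `z`, where `u = w + w⁻¹`. -/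
def zDenom {R : Type*} [CommRing R] (x u z : R) : R :=
  (1 - x * z) ^ 2 * (1 - u * x * z + x ^ 2 * z ^ 2)

/-- The numerator of the constant term in `z`. -/
def zConst {R : Type*} [CommRing R] (x u : R) : R :=
  1 + x ^ 2 + 2 * x ^ 3 + x ^ 3 * u + x ^ 4 + x ^ 6

/-- The numerator of the part of positive degree in the partial fraction decomposition in `z`. -/
def zPos {R : Type*} [CommRing R] (x u z : R) : R :=
  (2 * x + x * u + 2 * x ^ 2 + 2 * x ^ 2 * u + 2 * x ^ 3 + x ^ 3 * u + 2 * x ^ 4 + 2 * x ^ 4 * u +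
    2 * x ^ 5 + x ^ 5 * u) +
    (-2 * x ^ 2 - 2 * x ^ 2 * u - 2 * x ^ 3 - x ^ 3 * u - 2 * x ^ 4 - 2 * x ^ 4 * u - 4 * x ^ 5 -
      6 * x ^ 5 * u - 2 * x ^ 5 * u ^ 2 - 4 * x ^ 6 - 4 * x ^ 6 * u - x ^ 6 * u ^ 2) * z +
    (2 * x ^ 3 + x ^ 3 * u + x ^ 4 + 2 * x ^ 5 + x ^ 5 * u + 5 * x ^ 6 + 4 * x ^ 6 * u +
      x ^ 6 * u ^ 2 + 4 * x ^ 7 + 2 * x ^ 7 * u + x ^ 8 + 2 * x ^ 9 + x ^ 9 * u + x ^ 10) * z ^ 2 +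
    (-x ^ 4 - x ^ 6 - 2 * x ^ 7 - x ^ 7 * u - x ^ 8 - x ^ 10) * z ^ 3

/-- The numerator of the part of negative degree in the partial fraction decomposition in `z`. -/
def zNeg {R : Type*} [CommRing R] (x u z : R) : R :=
  (-1 - x ^ 2 - 2 * x ^ 3 - x ^ 3 * u - x ^ 4 - x ^ 6) +
    (-2 * x ^ 2 - 2 * x ^ 2 * u + 2 * x ^ 4 + 2 * x ^ 4 * u + x ^ 4 * u ^ 2 + 2 * x ^ 7 +
      x ^ 7 * u) * z +
    (2 * x ^ 3 + x ^ 3 * u + 2 * x ^ 6 + 2 * x ^ 6 * u + x ^ 6 * u ^ 2 - 2 * x ^ 8 -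
      2 * x ^ 8 * u) * z ^ 2 +
    (-x ^ 4 - x ^ 6 - 2 * x ^ 7 - x ^ 7 * u - x ^ 8 - x ^ 10) * z ^ 3

/-- The factors of positive weight in `w` of the denominator of the constant term in `z`. -/
def wDenom {R : Type*} [CommRing R] (x w : R) : R :=
  (1 - x * w) ^ 2 * ((1 - x ^ 2 * w) ^ 2 * (1 + x * w))

/-- The numerator of the Hilbert series. -/
def hilbertNum {R : Type*} [CommRing R] (x : R) : R :=
  1 - x ^ 2 - x ^ 3 + 2 * x ^ 4 + 2 * x ^ 5 + 2 * x ^ 6 - x ^ 7 - x ^ 8 + x ^ 10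

/-- The numerator of the part of positive degree in the partial fraction decomposition in `w`. -/
def wPos {R : Type*} [CommRing R] (x w : R) : R :=
  (x + x ^ 2 + 2 * x ^ 3 + x ^ 4 + 2 * x ^ 5 + x ^ 6 + 2 * x ^ 7 + x ^ 8 + x ^ 9) +
    (x ^ 2 - x ^ 3 - x ^ 5 - 3 * x ^ 7 - 2 * x ^ 8 - 5 * x ^ 9 - 3 * x ^ 10 - 2 * x ^ 11) * w +
    (-x ^ 3 - 2 * x ^ 4 + 2 * x ^ 6 + x ^ 7 - 3 * x ^ 8 - 6 * x ^ 9 - 5 * x ^ 10 + 3 * x ^ 12 +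
      2 * x ^ 13 + x ^ 14) * w ^ 2 +
    (2 * x ^ 5 + x ^ 6 - x ^ 7 - 3 * x ^ 8 + 2 * x ^ 9 + 5 * x ^ 10 + 8 * x ^ 11 + 2 * x ^ 12 -
      x ^ 13 - 2 * x ^ 14 + x ^ 15 + x ^ 16 + x ^ 17) * w ^ 3 +
    (-x ^ 7 + x ^ 9 + x ^ 10 - 2 * x ^ 11 - 2 * x ^ 12 - 2 * x ^ 13 + x ^ 14 + x ^ 15 -
      x ^ 17) * w ^ 4

/-- The numerator of the part of negative degree in the partial fraction decomposition in `w`. -/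
def wNeg {R : Type*} [CommRing R] (x w : R) : R :=
  (-1 + x ^ 2 + x ^ 3 - 2 * x ^ 4 - 2 * x ^ 5 - 2 * x ^ 6 + x ^ 7 + x ^ 8 - x ^ 10) +
    (x ^ 2 - 3 * x ^ 3 - 4 * x ^ 4 - 2 * x ^ 5 + 5 * x ^ 6 + 4 * x ^ 7 + 2 * x ^ 8 - 4 * x ^ 9 -
      2 * x ^ 10 + x ^ 11 + 2 * x ^ 12) * w +
    (-x ^ 3 - 2 * x ^ 4 + 2 * x ^ 5 + 5 * x ^ 6 + 2 * x ^ 7 - 2 * x ^ 8 - 2 * x ^ 9 + 2 * x ^ 10 +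
      5 * x ^ 11 + 2 * x ^ 12 - 2 * x ^ 13 - x ^ 14) * w ^ 2 +
    (2 * x ^ 5 + x ^ 6 - 2 * x ^ 7 - 4 * x ^ 8 + 2 * x ^ 9 + 4 * x ^ 10 + 5 * x ^ 11 - 2 * x ^ 12
      - 4 * x ^ 13 - 3 * x ^ 14 + x ^ 15) * w ^ 3 +
    (-x ^ 7 + x ^ 9 + x ^ 10 - 2 * x ^ 11 - 2 * x ^ 12 - 2 * x ^ 13 + x ^ 14 + x ^ 15 -
      x ^ 17) * w ^ 4

theorem partialFraction_z {R : Type*} [CommRing R] {x u z z' : R} (h : z * z' = 1) :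
    (1 - z') * ((1 - x) * (1 + x) ^ 3 * ((1 - u * x ^ 2 + x ^ 4) ^ 2 * (1 + u * x + x ^ 2))) =
      zConst x u * zDenom x u z * zDenom x u z' + z * zPos x u z * zDenom x u z' +
        z' * zNeg x u z' * zDenom x u z := by
  have h0 : z ^ 4 * z' = z ^ 3 := by linear_combination z ^ 3 * h
  have h1 : z ^ 4 * zDenom x u z' = (z - x) ^ 2 * (z ^ 2 - u * x * z + x ^ 2) := by
    have e1 : z * (1 - x * z') = z - x := by linear_combination -x * h
    have e2 : z ^ 2 * (1 - u * x * z' + x ^ 2 * z' ^ 2) = z ^ 2 - u * x * z + x ^ 2 := by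
      linear_combination (-u * x * z + x ^ 2 * (z * z' + 1)) * h
    rw [← e1, ← e2, zDenom]; ring
  obtain ⟨B, hB⟩ : ∃ B, B = z' * zNeg x u z' := ⟨_, rfl⟩
  have h2 : z ^ 4 * B = 
        (-1 - x ^ 2 - 2 * x ^ 3 - x ^ 3 * u - x ^ 4 - x ^ 6)* z ^ 3 + (-2 * x ^ 2 - 2 * x ^ 2 * u
          + 2 * x ^ 4 + 2 * x ^ 4 * u + x ^ 4 * u ^ 2 + 2 * x ^ 7 + x ^ 7 * u)* z ^ 2 + (2 * x ^ 3
          + x ^ 3 * u + 2 * x ^ 6 + 2 * x ^ 6 * u + x ^ 6 * u ^ 2 - 2 * x ^ 8 - 2 * x ^ 8 * u)* z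
          + (-x ^ 4 - x ^ 6 - 2 * x ^ 7 - x ^ 7 * u - x ^ 8 - x ^ 10) := by
    have e2 : z ^ 4 * z' ^ 2 = z ^ 2 := by linear_combination z ^ 2 * (z * z' + 1) * h
    have e3 : z ^ 4 * z' ^ 3 = z := by
      linear_combination z * ((z * z') ^ 2 + z * z' + 1) * h
    have e4 : z ^ 4 * z' ^ 4 = 1 := by
      linear_combination ((z * z') ^ 3 + (z * z') ^ 2 + z * z' + 1) * h
    rw [hB, zNeg]
    linear_combination 
        (-1 - x ^ 2 - 2 * x ^ 3 - x ^ 3 * u - x ^ 4 - x ^ 6) * h0 + (-2 * x ^ 2 - 2 * x ^ 2 * u +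
          2 * x ^ 4 + 2 * x ^ 4 * u + x ^ 4 * u ^ 2 + 2 * x ^ 7 + x ^ 7 * u) * e2 + (2 * x ^ 3 +
          x ^ 3 * u + 2 * x ^ 6 + 2 * x ^ 6 * u + x ^ 6 * u ^ 2 - 2 * x ^ 8 - 2 * x ^ 8 * u) * e3
          + (-x ^ 4 - x ^ 6 - 2 * x ^ 7 - x ^ 7 * u - x ^ 8 - x ^ 10) * e4
  have hz : IsUnit (z ^ 4) := (IsUnit.of_mul_eq_one z' h).pow 4
  rw [← hB, ← hz.mul_right_inj]
  obtain ⟨D, hD⟩ : ∃ D, D = zDenom x u z' := ⟨_, rfl⟩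
  rw [← hD] at h1 ⊢
  linear_combination (norm := skip)
    -((1 - x) * (1 + x) ^ 3 * ((1 - u * x ^ 2 + x ^ 4) ^ 2 * (1 + u * x + x ^ 2))) * h0 -
      (zConst x u * zDenom x u z + z * zPos x u z) * h1 - zDenom x u z * h2
  unfold zDenom zPos zConst
  ring

theorem partialFraction_w {R : Type*} [CommRing R] {x w w' : R} (h : w * w' = 1) :
    (1 - x) ^ 5 * (1 + x) ^ 3 * (1 + x ^ 2) ^ 2 * (1 + x + x ^ 2) ^ 3 *
        ((1 - w') * zConst x (w + w')) =
      hilbertNum x * wDenom x w * wDenom x w' + w * wPos x w * wDenom x w' +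
        w' * wNeg x w' * wDenom x w := by
  have h0 : w ^ 5 * w' = w ^ 4 := by linear_combination w ^ 4 * h
  have f2 : w ^ 5 * w' ^ 2 = w ^ 3 := by linear_combination w ^ 3 * (w * w' + 1) * h
  have f3 : w ^ 5 * w' ^ 3 = w ^ 2 := by
    linear_combination w ^ 2 * ((w * w') ^ 2 + w * w' + 1) * h
  have f4 : w ^ 5 * w' ^ 4 = w := by
    linear_combination w * ((w * w') ^ 3 + (w * w') ^ 2 + w * w' + 1) * h
  have f5 : w ^ 5 * w' ^ 5 = 1 := by
    linear_combination ((w * w') ^ 4 + (w * w') ^ 3 + (w * w') ^ 2 + w * w' + 1) * h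
  have h1 : w ^ 5 * wDenom x w' = (w - x) ^ 2 * ((w - x ^ 2) ^ 2 * (w + x)) := by
    have e1 : w * (1 - x * w') = w - x := by linear_combination -x * h
    have e2 : w * (1 - x ^ 2 * w') = w - x ^ 2 := by linear_combination -x ^ 2 * h
    have e3 : w * (1 + x * w') = w + x := by linear_combination x * h
    rw [← e1, ← e2, ← e3, wDenom]; ring
  have h3 : w ^ 5 * ((1 - w') * zConst x (w + w')) = 
        (w ^ 5 - w ^ 4) * ((1 + x ^ 2 + 2 * x ^ 3 + x ^ 4 + x ^ 6) + x ^ 3 * w) + x ^ 3 * (w ^ 4 -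
          w ^ 3) := by
    simp only [zConst]
    linear_combination 
      (-((1 + x ^ 2 + 2 * x ^ 3 + x ^ 4 + x ^ 6) + x ^ 3 * w) + x ^ 3) * h0 - x ^ 3 * f2
  obtain ⟨B, hB⟩ : ∃ B, B = w' * wNeg x w' := ⟨_, rfl⟩
  have h2 : w ^ 5 * B = 
        (-1 + x ^ 2 + x ^ 3 - 2 * x ^ 4 - 2 * x ^ 5 - 2 * x ^ 6 + x ^ 7 + x ^ 8 - x ^ 10)* w ^ 4 +
          (x ^ 2 - 3 * x ^ 3 - 4 * x ^ 4 - 2 * x ^ 5 + 5 * x ^ 6 + 4 * x ^ 7 + 2 * x ^ 8 -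
          4 * x ^ 9 - 2 * x ^ 10 + x ^ 11 + 2 * x ^ 12)* w ^ 3 + (-x ^ 3 - 2 * x ^ 4 + 2 * x ^ 5 +
          5 * x ^ 6 + 2 * x ^ 7 - 2 * x ^ 8 - 2 * x ^ 9 + 2 * x ^ 10 + 5 * x ^ 11 + 2 * x ^ 12 -
          2 * x ^ 13 - x ^ 14)* w ^ 2 + (2 * x ^ 5 + x ^ 6 - 2 * x ^ 7 - 4 * x ^ 8 + 2 * x ^ 9 +
          4 * x ^ 10 + 5 * x ^ 11 - 2 * x ^ 12 - 4 * x ^ 13 - 3 * x ^ 14 + x ^ 15)* w + (-x ^ 7 +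
          x ^ 9 + x ^ 10 - 2 * x ^ 11 - 2 * x ^ 12 - 2 * x ^ 13 + x ^ 14 + x ^ 15 - x ^ 17) := by
    rw [hB, wNeg]
    linear_combination 
        (-1 + x ^ 2 + x ^ 3 - 2 * x ^ 4 - 2 * x ^ 5 - 2 * x ^ 6 + x ^ 7 + x ^ 8 - x ^ 10) * h0 +
          (x ^ 2 - 3 * x ^ 3 - 4 * x ^ 4 - 2 * x ^ 5 + 5 * x ^ 6 + 4 * x ^ 7 + 2 * x ^ 8 -
          4 * x ^ 9 - 2 * x ^ 10 + x ^ 11 + 2 * x ^ 12) * f2 + (-x ^ 3 - 2 * x ^ 4 + 2 * x ^ 5 +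
          5 * x ^ 6 + 2 * x ^ 7 - 2 * x ^ 8 - 2 * x ^ 9 + 2 * x ^ 10 + 5 * x ^ 11 + 2 * x ^ 12 -
          2 * x ^ 13 - x ^ 14) * f3 + (2 * x ^ 5 + x ^ 6 - 2 * x ^ 7 - 4 * x ^ 8 + 2 * x ^ 9 +
          4 * x ^ 10 + 5 * x ^ 11 - 2 * x ^ 12 - 4 * x ^ 13 - 3 * x ^ 14 + x ^ 15) * f4 + (-x ^ 7
          + x ^ 9 + x ^ 10 - 2 * x ^ 11 - 2 * x ^ 12 - 2 * x ^ 13 + x ^ 14 + x ^ 15 - x ^ 17) * f5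
  have hw : IsUnit (w ^ 5) := (IsUnit.of_mul_eq_one w' h).pow 5
  obtain ⟨D, hD⟩ : ∃ D, D = wDenom x w' := ⟨_, rfl⟩
  obtain ⟨C, hC⟩ : ∃ C, C = (1 - w') * zConst x (w + w') := ⟨_, rfl⟩
  rw [← hB, ← hC, ← hD, ← hw.mul_right_inj]
  rw [← hD] at h1
  rw [← hC] at h3
  linear_combination (norm := skip)
    ((1 - x) ^ 5 * (1 + x) ^ 3 * (1 + x ^ 2) ^ 2 * (1 + x + x ^ 2) ^ 3) * h3 -
      (hilbertNum x * wDenom x w + w * wPos x w) * h1 - wDenom x w * h2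
  unfold wDenom wPos hilbertNum
  ring

/-- The geometric combination of both partial fraction decompositions. -/
theorem torus_decomposition {R : Type*} [CommRing R] {x z z' w w' G iP iM iD iD' : R}
    (hz : z * z' = 1) (hw : w * w' = 1) (hP : wDenom x w * iP = 1) (hM : wDenom x w' * iM = 1)
    (hD : zDenom x (w + w') z * iD = 1) (hD' : zDenom x (w + w') z' * iD' = 1)
    (hG : G * ((1 - x) ^ 4 * ((1 - x * w) ^ 2 * (1 - x * w') ^ 2) *
      (zDenom x (w + w') z * zDenom x (w + w') z')) = 1) :
    (1 - x) * (1 - x ^ 2) ^ 4 * (1 - x ^ 3) ^ 3 * (1 - x ^ 4) ^ 2 *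
        ((1 - z') * (1 - w') * G) =
      hilbertNum x + w * (wPos x w * iP) + w' * (wNeg x w' * iM) +
        z * ((1 - x) ^ 5 * (1 + x) ^ 3 * (1 + x ^ 2) ^ 2 * (1 + x + x ^ 2) ^ 3 * (1 - w') *
          zPos x (w + w') z * (iP * iM * iD)) +
        z' * ((1 - x) ^ 5 * (1 + x) ^ 3 * (1 + x ^ 2) ^ 2 * (1 + x + x ^ 2) ^ 3 * (1 - w') *
          zNeg x (w + w') z' * (iP * iM * iD')) := by
  have cz := partialFraction_z (x := x) (u := w + w') hz
  have cw := partialFraction_w (x := x) hw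
  have e1 : (1 - (w + w') * x ^ 2 + x ^ 4) ^ 2 * (1 + (w + w') * x + x ^ 2) =
      ((1 - x ^ 2 * w) ^ 2 * (1 + x * w)) * ((1 - x ^ 2 * w') ^ 2 * (1 + x * w')) := by
    have a : 1 - (w + w') * x ^ 2 + x ^ 4 = (1 - x ^ 2 * w) * (1 - x ^ 2 * w') := by
      linear_combination -x ^ 4 * hw
    have b : 1 + (w + w') * x + x ^ 2 = (1 + x * w) * (1 + x * w') := by
      linear_combination -x ^ 2 * hw
    rw [a, b]; ring
  rw [e1] at cz
  generalize zDenom x (w + w') z = D at *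
  generalize zDenom x (w + w') z' = D' at *
  generalize zPos x (w + w') z = A at *
  generalize zNeg x (w + w') z' = B at *
  generalize zConst x (w + w') = C at *
  generalize wPos x w = A' at *
  generalize wNeg x w' = B' at *
  generalize hilbertNum x = N at *
  have hS : (1 - x) ^ 4 * G = ((1 - x ^ 2 * w) ^ 2 * (1 + x * w)) *
      ((1 - x ^ 2 * w') ^ 2 * (1 + x * w')) * (iP * iM * iD * iD') := by
    calc (1 - x) ^ 4 * G = (1 - x) ^ 4 * G * ((wDenom x w * iP) * (wDenom x w' * iM) *
          (D * iD) * (D' * iD')) := by rw [hP, hM, hD, hD']; ring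
      _ = G * ((1 - x) ^ 4 * ((1 - x * w) ^ 2 * (1 - x * w') ^ 2) * (D * D')) *
          (((1 - x ^ 2 * w) ^ 2 * (1 + x * w)) *
      ((1 - x ^ 2 * w') ^ 2 * (1 + x * w')) * (iP * iM * iD * iD')) := by
          unfold wDenom; ring
      _ = _ := by rw [hG, one_mul]
  generalize (1 - x ^ 2 * w) ^ 2 * (1 + x * w) = V at *
  generalize (1 - x ^ 2 * w') ^ 2 * (1 + x * w') = V' at *
  generalize wDenom x w = P at *
  generalize wDenom x w' = M at *
  have hQ : (1 - x) * (1 - x ^ 2) ^ 4 * (1 - x ^ 3) ^ 3 * (1 - x ^ 4) ^ 2 =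
      ((1 - x) ^ 5 * (1 + x) ^ 3 * (1 + x ^ 2) ^ 2 * (1 + x + x ^ 2) ^ 3) *
        ((1 - x) * (1 + x) ^ 3) * (1 - x) ^ 4 := by ring
  rw [hQ]
  generalize (1 - x) ^ 5 * (1 + x) ^ 3 * (1 + x ^ 2) ^ 2 * (1 + x + x ^ 2) ^ 3 = Q at *
  generalize (1 - x) * (1 + x) ^ 3 = q at *
  generalize (1 - x) ^ 4 = r at *
  calc Q * q * r * ((1 - z') * (1 - w') * G)
      = Q * (1 - w') * ((1 - z') * (q * (V * V'))) * (iP * iM * iD * iD') := by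
        linear_combination Q * q * (1 - z') * (1 - w') * hS
    _ = Q * (1 - w') * (C * (D * iD) * (D' * iD') + z * A * (D' * iD') * iD +
          z' * B * (D * iD) * iD') * (iP * iM) := by rw [cz]; ring
    _ = Q * ((1 - w') * C) * (iP * iM) + z * (Q * (1 - w') * A * (iP * iM * iD)) +
          z' * (Q * (1 - w') * B * (iP * iM * iD')) := by rw [hD, hD']; ring
    _ = N * (P * iP) * (M * iM) + w * (A' * iP) * (M * iM) + w' * (B' * iM) * (P * iP) +
          z * (Q * (1 - w') * A * (iP * iM * iD)) +
          z' * (Q * (1 - w') * B * (iP * iM * iD')) := by rw [cw]; ring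
    _ = _ := by rw [hP, hM]; ring

/-- The Laurent polynomials with all exponents in a given submonoid. -/
noncomputable def AddMonoidAlgebra.supportedSubring (S : AddSubmonoid (ℤ × ℤ)) :
    Subring (AddMonoidAlgebra ℤ (ℤ × ℤ)) :=
  (AddMonoidAlgebra.mapDomainRingHom ℤ S.subtype).range

/-- The power series with coefficients in a given subring. -/
noncomputable def PowerSeries.coeffSubring {L : Type*} [CommRing L] (A : Subring L) :
    Subring L⟦X⟧ :=
  (PowerSeries.map A.subtype).range

theorem PowerSeries.mem_coeffSubring_of_mul_eq_one {L : Type*} [CommRing L] {A : Subring L}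
    {f g : L⟦X⟧} (hf : f ∈ coeffSubring A) (h0 : constantCoeff f = 1) (hfg : f * g = 1) :
    g ∈ coeffSubring A := by
  obtain ⟨f, rfl⟩ := hf
  have hu : IsUnit f := by
    rw [PowerSeries.isUnit_iff_constantCoeff]
    have : constantCoeff f = 1 := Subtype.ext (by
      rw [← coeff_zero_eq_constantCoeff_apply, coeff_map, coeff_zero_eq_constantCoeff_apply] at h0
      exact h0)
    rw [this]; exact isUnit_one
  obtain ⟨f', hf'⟩ := hu.exists_right_inv
  refine ⟨f', ?_⟩
  have h1 : PowerSeries.map A.subtype f * PowerSeries.map A.subtype f' = 1 := by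
    rw [← map_mul, hf', map_one]
  calc PowerSeries.map A.subtype f' = PowerSeries.map A.subtype f' * (_ * g) := by
        rw [hfg, mul_one]
    _ = g := by rw [mul_comm, mul_right_comm, h1, one_mul]

/-- Taking the constant term in the Laurent variables, coefficientwise. -/
noncomputable def constantTerm : (AddMonoidAlgebra ℤ (ℤ × ℤ))⟦X⟧ →+ ℤ⟦X⟧ where
  toFun f := PowerSeries.mk fun n => (coeff n f).coeff 0
  map_zero' := by ext; simp
  map_add' f g := by ext; simp

/-- The Laurent monomial with a given exponent, as a constant power series. -/
noncomputable def laurentMonomial (s : ℤ × ℤ) : (AddMonoidAlgebra ℤ (ℤ × ℤ))⟦X⟧ :=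
  C (AddMonoidAlgebra.single s 1)

theorem laurentMonomial_add (s t : ℤ × ℤ) :
    laurentMonomial (s + t) = laurentMonomial s * laurentMonomial t := by
  rw [laurentMonomial, laurentMonomial, laurentMonomial, ← map_mul,
    AddMonoidAlgebra.single_mul_single, one_mul]

theorem laurentMonomial_zero : laurentMonomial 0 = 1 := by
  rw [laurentMonomial, ← AddMonoidAlgebra.one_def, map_one]

theorem laurentMonomial_mem {S : AddSubmonoid (ℤ × ℤ)} {s : ℤ × ℤ} (hs : s ∈ S) :
    laurentMonomial s ∈ coeffSubring (AddMonoidAlgebra.supportedSubring S) := by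
  refine ⟨C ⟨AddMonoidAlgebra.single s 1, AddMonoidAlgebra.single ⟨s, hs⟩ 1, ?_⟩, ?_⟩
  · simp
  · simp [laurentMonomial]

theorem constantTerm_map_mul (q : ℤ⟦X⟧) (f : (AddMonoidAlgebra ℤ (ℤ × ℤ))⟦X⟧) :
    constantTerm (PowerSeries.map (algebraMap ℤ _) q * f) = q * constantTerm f := by
  ext n
  simp [constantTerm, coeff_mul, AddMonoidAlgebra.coeff_sum, Finsupp.finsetSum_apply,
    ← zsmul_eq_mul]

theorem constantTerm_laurentMonomial_mul {S : AddSubmonoid (ℤ × ℤ)} {s : ℤ × ℤ} (hs : -s ∉ S)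
    {f : (AddMonoidAlgebra ℤ (ℤ × ℤ))⟦X⟧}
    (hf : f ∈ coeffSubring (AddMonoidAlgebra.supportedSubring S)) :
    constantTerm (laurentMonomial s * f) = 0 := by
  obtain ⟨f, rfl⟩ := hf
  ext n
  obtain ⟨p, hp⟩ := (coeff n f).2
  simp only [constantTerm, laurentMonomial, AddMonoidHom.coe_mk, ZeroHom.coe_mk, coeff_mk,
    coeff_C_mul, coeff_map, Subring.subtype_apply, ← hp, map_zero]
  rw [AddMonoidAlgebra.coeff_single_mul_apply, one_mul, add_zero]
  simp only [AddMonoidAlgebra.mapDomainRingHom_apply, AddMonoidAlgebra.coeff_mapDomain]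
  exact Finsupp.mapDomain_of_notMem_range _ _ (by simpa using hs)

/-- The generating function of the monomials in variables of given weights, by degree. -/
noncomputable def torusSeries {σ : Type*} [Fintype σ] (wt : σ → ℤ × ℤ) :
    (AddMonoidAlgebra ℤ (ℤ × ℤ))⟦X⟧ :=
  ∏ i, PowerSeries.mk fun k => AddMonoidAlgebra.single (k • wt i) 1

theorem torusSeries_mul_prod {σ : Type*} [Fintype σ] (wt : σ → ℤ × ℤ) :
    torusSeries wt * ∏ i, (1 - X * laurentMonomial (wt i)) = 1 := by
  rw [torusSeries, ← Finset.prod_mul_distrib]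
  refine Finset.prod_eq_one fun i _ => ?_
  ext n : 1
  rw [mul_sub, mul_one, map_sub, mul_left_comm, laurentMonomial]
  cases n with
  | zero => simp [AddMonoidAlgebra.one_def]
  | succ n =>
    rw [coeff_succ_X_mul, coeff_mul_C, coeff_mk, coeff_mk, AddMonoidAlgebra.single_mul_single,
      succ_nsmul, mul_one, sub_self, coeff_one, if_neg n.succ_ne_zero]

/-- The number of monomials of given degree and weight. -/
def monomialCount {σ : Type*} [Fintype σ] [DecidableEq σ] (wt : σ → ℤ × ℤ) (n : ℕ)
    (s : ℤ × ℤ) : ℕ :=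
  ((Finset.univ.finsuppAntidiag n).filter fun l : σ →₀ ℕ => ∑ i, l i • wt i = s).card

theorem constantTerm_laurentMonomial_mul_torusSeries {σ : Type*} [Fintype σ] [DecidableEq σ]
    (wt : σ → ℤ × ℤ) (s : ℤ × ℤ) :
    constantTerm (laurentMonomial (-s) * torusSeries wt) =
      PowerSeries.mk fun n => (monomialCount wt n s : ℤ) := by
  have hprod (l : σ →₀ ℕ) : ∏ i, (AddMonoidAlgebra.single (l i • wt i) 1 :
      AddMonoidAlgebra ℤ (ℤ × ℤ)) = AddMonoidAlgebra.single (∑ i, l i • wt i) 1 := by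
    induction (Finset.univ : Finset σ) using Finset.induction_on with
    | empty => simp [AddMonoidAlgebra.one_def]
    | insert a t ha ih =>
      rw [Finset.prod_insert ha, Finset.sum_insert ha, ih, AddMonoidAlgebra.single_mul_single,
        mul_one]
  ext n
  simp only [constantTerm, laurentMonomial, torusSeries, AddMonoidHom.coe_mk, ZeroHom.coe_mk,
    coeff_mk, coeff_C_mul, coeff_prod, hprod, monomialCount]
  rw [AddMonoidAlgebra.coeff_single_mul_apply, AddMonoidAlgebra.coeff_sum,
    Finsupp.finsetSum_apply, Finset.card_filter]
  simp [Finsupp.single_apply]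

/-- The weights of the coordinates of `End (K² ⊗ K²)` under conjugation by the torus. -/
def endWeight (i : (Fin 2 × Fin 2) × (Fin 2 × Fin 2)) : ℤ × ℤ :=
  (i.1.1 - i.2.1, i.1.2 - i.2.2)

theorem prod_one_sub_endWeight {R : Type*} [CommRing R] (m : Multiplicative (ℤ × ℤ) →* R) {x : R}
    {z z' w w' : R} (hz : z = m (.ofAdd (1, 0))) (hz' : z' = m (.ofAdd (-1, 0)))
    (hw : w = m (.ofAdd (0, 1))) (hw' : w' = m (.ofAdd (0, -1))) :
    ∏ i, (1 - x * m (.ofAdd (endWeight i))) =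
      (1 - x) ^ 4 * ((1 - x * w) ^ 2 * (1 - x * w') ^ 2) *
        (zDenom x (w + w') z * zDenom x (w + w') z') := by
  have hww : w * w' = 1 := by
    rw [hw, hw', ← map_mul, ← ofAdd_add]
    exact map_one m
  have hDz (v : R) : zDenom x (w + w') v =
      (1 - x * v) ^ 2 * ((1 - x * (v * w)) * (1 - x * (v * w'))) := by
    rw [zDenom]
    linear_combination -(1 - x * v) ^ 2 * x ^ 2 * v ^ 2 * hww
  have h00 : m (.ofAdd (0, 0)) = 1 := map_one m
  have h11 : m (.ofAdd (1, 1)) = z * w := by rw [hz, hw, ← map_mul]; rfl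
  have h12 : m (.ofAdd (1, -1)) = z * w' := by rw [hz, hw', ← map_mul]; rfl
  have h21 : m (.ofAdd (-1, 1)) = z' * w := by rw [hz', hw, ← map_mul]; rfl
  have h22 : m (.ofAdd (-1, -1)) = z' * w' := by rw [hz', hw', ← map_mul]; rfl
  rw [hDz, hDz]
  simp only [Fintype.prod_prod_type, Fin.prod_univ_two, endWeight, Fin.val_zero, Fin.val_one,
    Nat.cast_zero, Nat.cast_one, sub_self, zero_sub, sub_zero, h00, h11, h12, h21, h22, ← hz,
    ← hz', ← hw, ← hw', mul_one]
  generalize 1 - x = a₁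
  generalize 1 - x * w = a₂
  generalize 1 - x * w' = a₃
  generalize 1 - x * z = a₄
  generalize 1 - x * z' = a₅
  generalize 1 - x * (z * w) = a₆
  generalize 1 - x * (z * w') = a₇
  generalize 1 - x * (z' * w) = a₈
  generalize 1 - x * (z' * w') = a₉
  ring

section Membership

variable {R : Type*} [CommRing R] {T : Subring R} {x u v w w' : R}

theorem wDenom_mem (hx : x ∈ T) (hv : v ∈ T) : wDenom x v ∈ T :=
  (wDenom (⟨x, hx⟩ : T) ⟨v, hv⟩).2

theorem zDenom_mem (hx : x ∈ T) (hu : u ∈ T) (hv : v ∈ T) : zDenom x u v ∈ T :=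
  (zDenom (⟨x, hx⟩ : T) ⟨u, hu⟩ ⟨v, hv⟩).2

theorem zPos_mem (hx : x ∈ T) (hu : u ∈ T) (hv : v ∈ T) : zPos x u v ∈ T :=
  (zPos (⟨x, hx⟩ : T) ⟨u, hu⟩ ⟨v, hv⟩).2

theorem zNeg_mem (hx : x ∈ T) (hu : u ∈ T) (hv : v ∈ T) : zNeg x u v ∈ T :=
  (zNeg (⟨x, hx⟩ : T) ⟨u, hu⟩ ⟨v, hv⟩).2

theorem wPos_mem (hx : x ∈ T) (hv : v ∈ T) : wPos x v ∈ T :=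
  (wPos (⟨x, hx⟩ : T) ⟨v, hv⟩).2

theorem wNeg_mem (hx : x ∈ T) (hv : v ∈ T) : wNeg x v ∈ T :=
  (wNeg (⟨x, hx⟩ : T) ⟨v, hv⟩).2

theorem zFactor_mem (hx : x ∈ T) (hv : v ∈ T) : (1 - x) ^ 5 * (1 + x) ^ 3 *
    (1 + x ^ 2) ^ 2 * (1 + x + x ^ 2) ^ 3 * (1 - v) ∈ T :=
  ((1 - ⟨x, hx⟩) ^ 5 * (1 + ⟨x, hx⟩) ^ 3 * (1 + ⟨x, hx⟩ ^ 2) ^ 2 *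
    (1 + ⟨x, hx⟩ + ⟨x, hx⟩ ^ 2) ^ 3 * (1 - ⟨v, hv⟩) : T).2

theorem zPos_part_mem {z iP iM iD : R} (hx : x ∈ T) (hw : w ∈ T) (hw' : w' ∈ T) (hz : z ∈ T)
    (hP : iP ∈ T) (hM : iM ∈ T) (hD : iD ∈ T) :
    (1 - x) ^ 5 * (1 + x) ^ 3 * (1 + x ^ 2) ^ 2 * (1 + x + x ^ 2) ^ 3 * (1 - w') *
      zPos x (w + w') z * (iP * iM * iD) ∈ T :=
  mul_mem (mul_mem (zFactor_mem hx hw') (zPos_mem hx (add_mem hw hw') hz))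
    (mul_mem (mul_mem hP hM) hD)

theorem zNeg_part_mem {z iP iM iD : R} (hx : x ∈ T) (hw : w ∈ T) (hw' : w' ∈ T) (hz : z ∈ T)
    (hP : iP ∈ T) (hM : iM ∈ T) (hD : iD ∈ T) :
    (1 - x) ^ 5 * (1 + x) ^ 3 * (1 + x ^ 2) ^ 2 * (1 + x + x ^ 2) ^ 3 * (1 - w') *
      zNeg x (w + w') z * (iP * iM * iD) ∈ T :=
  mul_mem (mul_mem (zFactor_mem hx hw') (zNeg_mem hx (add_mem hw hw') hz))
    (mul_mem (mul_mem hP hM) hD)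

end Membership

theorem map_hilbertNum {R S : Type*} [CommRing R] [CommRing S] (f : R →+* S) (x : R) :
    f (hilbertNum x) = hilbertNum (f x) := by
  have h : f 2 = 2 := map_ofNat f 2
  simp [hilbertNum, h]

theorem constantTerm_hilbertNum : constantTerm (hilbertNum X) = hilbertNum X := by
  have h : PowerSeries.map (algebraMap ℤ (AddMonoidAlgebra ℤ (ℤ × ℤ))) (hilbertNum X) =
      hilbertNum X := by
    rw [map_hilbertNum, map_X]
  have h1 : constantTerm 1 = 1 := by
    ext n
    by_cases hn : n = 0 <;> simp [constantTerm, coeff_one, hn, AddMonoidAlgebra.one_def]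
  have := constantTerm_map_mul (hilbertNum X) 1
  rwa [h1, mul_one, mul_one, h] at this

theorem constantTerm_torusSeries_endWeight :
    constantTerm ((1 - laurentMonomial (-1, 0)) * (1 - laurentMonomial (0, -1)) *
        torusSeries endWeight) =
      PowerSeries.mk fun n => (monomialCount endWeight n (0, 0) : ℤ) -
        monomialCount endWeight n (1, 0) - monomialCount endWeight n (0, 1) +
        monomialCount endWeight n (1, 1) := by
  have e : (1 - laurentMonomial (-1, 0)) * (1 - laurentMonomial (0, -1)) *
        torusSeries endWeight =
      laurentMonomial (-(0, 0)) * torusSeries endWeight -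
        laurentMonomial (-(1, 0)) * torusSeries endWeight -
        laurentMonomial (-(0, 1)) * torusSeries endWeight +
        laurentMonomial (-(1, 1)) * torusSeries endWeight := by
    rw [show (-(0, 0) : ℤ × ℤ) = 0 from rfl, show (-(1, 0) : ℤ × ℤ) = (-1, 0) from rfl,
      show (-(0, 1) : ℤ × ℤ) = (0, -1) from rfl,
      show (-(1, 1) : ℤ × ℤ) = (-1, 0) + (0, -1) from rfl, laurentMonomial_add,
      laurentMonomial_zero]
    ring
  rw [e]
  simp only [map_add, map_sub, constantTerm_laurentMonomial_mul_torusSeries]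
  ext n
  simp

/-- The subring of series supported in a submonoid of weights, by its properties. -/
theorem exists_subring_constantTerm_eq_zero (S : AddSubmonoid (ℤ × ℤ)) :
    ∃ T : Subring (AddMonoidAlgebra ℤ (ℤ × ℤ))⟦X⟧, X ∈ T ∧ (∀ s ∈ S, laurentMonomial s ∈ T) ∧
      (∀ f ∈ T, ∀ g, constantCoeff f = 1 → f * g = 1 → g ∈ T) ∧
      ∀ s, -s ∉ S → ∀ f ∈ T, constantTerm (laurentMonomial s * f) = 0 :=
  ⟨coeffSubring (AddMonoidAlgebra.supportedSubring S), ⟨X, by simp⟩,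
    fun _ hs => laurentMonomial_mem hs, fun _ hf _ h h' => mem_coeffSubring_of_mul_eq_one hf h h',
    fun _ hs _ hf => constantTerm_laurentMonomial_mul hs hf⟩

theorem monomialCount_endWeight_series :
    (PowerSeries.mk fun n => (monomialCount endWeight n (0, 0) : ℤ) -
        monomialCount endWeight n (1, 0) - monomialCount endWeight n (0, 1) +
        monomialCount endWeight n (1, 1)) *
      ((1 - X) * (1 - X ^ 2) ^ 4 * (1 - X ^ 3) ^ 3 * (1 - X ^ 4) ^ 2) = hilbertNum X := by
  obtain ⟨T₁, x₁, l₁, i₁, v₁⟩ := exists_subring_constantTerm_eq_zero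
    ((AddSubmonoid.nonneg ℤ).comap (AddMonoidHom.fst ℤ ℤ))
  obtain ⟨T₂, x₂, l₂, i₂, v₂⟩ := exists_subring_constantTerm_eq_zero
    ((AddSubmonoid.nonneg ℤ).comap (-AddMonoidHom.fst ℤ ℤ))
  obtain ⟨T₃, x₃, l₃, i₃, v₃⟩ := exists_subring_constantTerm_eq_zero
    ((AddSubmonoid.nonneg ℤ).comap (AddMonoidHom.snd ℤ ℤ))
  obtain ⟨T₄, x₄, l₄, i₄, v₄⟩ := exists_subring_constantTerm_eq_zero
    ((AddSubmonoid.nonneg ℤ).comap (-AddMonoidHom.snd ℤ ℤ))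
  obtain ⟨z, hz⟩ : ∃ z, z = laurentMonomial (1, 0) := ⟨_, rfl⟩
  obtain ⟨z', hz'⟩ : ∃ z', z' = laurentMonomial (-1, 0) := ⟨_, rfl⟩
  obtain ⟨w, hw⟩ : ∃ w, w = laurentMonomial (0, 1) := ⟨_, rfl⟩
  obtain ⟨w', hw'⟩ : ∃ w', w' = laurentMonomial (0, -1) := ⟨_, rfl⟩
  have hzz : z * z' = 1 := by rw [hz, hz', ← laurentMonomial_add]; exact laurentMonomial_zero
  have hww : w * w' = 1 := by rw [hw, hw', ← laurentMonomial_add]; exact laurentMonomial_zero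
  obtain ⟨x, hx⟩ : ∃ x : (AddMonoidAlgebra ℤ (ℤ × ℤ))⟦X⟧, x = X := ⟨_, rfl⟩
  have hPc (v) : constantCoeff (wDenom x v) = 1 := by simp [wDenom, hx]
  have hDc (u v) : constantCoeff (zDenom x u v) = 1 := by simp [zDenom, hx]
  have hinv (f : (AddMonoidAlgebra ℤ (ℤ × ℤ))⟦X⟧) (hf : constantCoeff f = 1) :
      ∃ g, f * g = 1 :=
    (PowerSeries.isUnit_iff_constantCoeff.2 (by rw [hf]; exact isUnit_one)).exists_right_inv
  obtain ⟨iP, hP⟩ := hinv _ (hPc w)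
  obtain ⟨iM, hM⟩ := hinv _ (hPc w')
  obtain ⟨iD, hD⟩ := hinv _ (hDc (w + w') z)
  obtain ⟨iD', hD'⟩ := hinv _ (hDc (w + w') z')
  have hG : torusSeries endWeight * ((1 - x) ^ 4 * ((1 - x * w) ^ 2 * (1 - x * w') ^ 2) *
      (zDenom x (w + w') z * zDenom x (w + w') z')) = 1 := by
    let m : Multiplicative (ℤ × ℤ) →* (AddMonoidAlgebra ℤ (ℤ × ℤ))⟦X⟧ :=
      { toFun := fun s => laurentMonomial s.toAdd
        map_one' := laurentMonomial_zero
        map_mul' := fun s t => laurentMonomial_add _ _ }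
    rw [← prod_one_sub_endWeight m hz hz' hw hw', hx]
    exact torusSeries_mul_prod endWeight
  have key := torus_decomposition hzz hww hP hM hD hD' hG
  rw [← hx] at x₁ x₂ x₃ x₄
  have v₁' := v₁ (1, 0) (by simp)
  have v₂' := v₂ (-1, 0) (by simp)
  have v₃' := v₃ (0, 1) (by simp)
  have v₄' := v₄ (0, -1) (by simp)
  have z₁ := l₁ (1, 0) (by simp)
  have w₁ := l₁ (0, 1) (by simp)
  have w₁' := l₁ (0, -1) (by simp)
  have z₂ := l₂ (-1, 0) (by simp)
  have w₂ := l₂ (0, 1) (by simp)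
  have w₂' := l₂ (0, -1) (by simp)
  have w₃ := l₃ (0, 1) (by simp)
  have w₄' := l₄ (0, -1) (by simp)
  rw [← hz] at v₁' z₁
  rw [← hz'] at v₂' z₂
  rw [← hw] at v₃' w₁ w₂ w₃
  rw [← hw'] at v₄' w₁' w₂' w₄'
  have c₁ := v₁' _ (zPos_part_mem x₁ w₁ w₁' z₁ (i₁ _ (wDenom_mem x₁ w₁) _ (hPc w) hP)
    (i₁ _ (wDenom_mem x₁ w₁') _ (hPc w') hM)
    (i₁ _ (zDenom_mem x₁ (add_mem w₁ w₁') z₁) _ (hDc _ z) hD))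
  have c₂ := v₂' _ (zNeg_part_mem x₂ w₂ w₂' z₂ (i₂ _ (wDenom_mem x₂ w₂) _ (hPc w) hP)
    (i₂ _ (wDenom_mem x₂ w₂') _ (hPc w') hM)
    (i₂ _ (zDenom_mem x₂ (add_mem w₂ w₂') z₂) _ (hDc _ z') hD'))
  have c₃ := v₃' _ (mul_mem (wPos_mem x₃ w₃) (i₃ _ (wDenom_mem x₃ w₃) _ (hPc w) hP))
  have c₄ := v₄' _ (mul_mem (wNeg_mem x₄ w₄') (i₄ _ (wDenom_mem x₄ w₄') _ (hPc w') hM))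
  have hQ : (1 - x) * (1 - x ^ 2) ^ 4 * (1 - x ^ 3) ^ 3 * (1 - x ^ 4) ^ 2 =
      PowerSeries.map (algebraMap ℤ (AddMonoidAlgebra ℤ (ℤ × ℤ)))
        ((1 - X) * (1 - X ^ 2) ^ 4 * (1 - X ^ 3) ^ 3 * (1 - X ^ 4) ^ 2) := by
    simp [hx]
  have := congrArg constantTerm key
  rw [hQ, constantTerm_map_mul, hz', hw', constantTerm_torusSeries_endWeight, ← hz', ← hw',
    map_add, map_add, map_add, map_add, c₁, c₂, c₃, c₄, hx, constantTerm_hilbertNum] at this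
  rw [mul_comm, this]
  simp only [add_zero]

section ConjDerivation

variable {ι K : Type*} [Fintype ι] [Field K]

/-- The derivation of the coordinate ring of matrices given by `X ↦ X A - A X`. -/
noncomputable def conjDerivation (A : Matrix ι ι K) :
    Derivation K (MvPolynomial (ι × ι) K) (MvPolynomial (ι × ι) K) :=
  MvPolynomial.mkDerivation K fun p =>
    ∑ k, A k p.2 • MvPolynomial.X (p.1, k) - ∑ k, A p.1 k • MvPolynomial.X (k, p.2)

theorem conjDerivation_X (A : Matrix ι ι K) (p : ι × ι) :
    conjDerivation A (MvPolynomial.X p) =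
      ∑ k, A k p.2 • MvPolynomial.X (p.1, k) - ∑ k, A p.1 k • MvPolynomial.X (k, p.2) :=
  MvPolynomial.mkDerivation_X _ _ _

theorem conjDerivation_commutator (A B : Matrix ι ι K) :
    ⁅conjDerivation A, conjDerivation B⁆ = conjDerivation (A * B - B * A) := by
  refine MvPolynomial.derivation_ext fun ⟨i, j⟩ => ?_
  simp only [Derivation.commutator_apply, conjDerivation_X, map_sub, map_sum, Derivation.map_smul,
    Matrix.sub_apply, Matrix.mul_apply, sub_smul, Finset.sum_smul, smul_sub, Finset.smul_sum,
    Finset.sum_sub_distrib, smul_smul]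
  have h1 (f : ι → ι → MvPolynomial (ι × ι) K) : ∑ k, ∑ l, f k l = ∑ k, ∑ l, f l k :=
    Finset.sum_comm
  rw [h1 fun k l => (A k l * B l j) • MvPolynomial.X (i, k),
    h1 fun k l => (B k l * A l j) • MvPolynomial.X (i, k),
    h1 fun k l => (A i l * B l k) • MvPolynomial.X (k, j),
    h1 fun k l => (B i l * A l k) • MvPolynomial.X (k, j),
    h1 fun k l => (B k j * A i l) • MvPolynomial.X (l, k),
    h1 fun k l => (A k j * B i l) • MvPolynomial.X (l, k)]
  simp only [mul_comm]
  abel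

theorem conjDerivation_smul (c : K) (A : Matrix ι ι K) :
    conjDerivation (c • A) = c • conjDerivation A :=
  MvPolynomial.derivation_ext fun p => by
    simp [conjDerivation_X, smul_sub, Finset.smul_sum, smul_smul]

theorem conjDerivation_zero : conjDerivation (0 : Matrix ι ι K) = 0 := by
  simpa using conjDerivation_smul 0 (0 : Matrix ι ι K)

theorem conjDerivation_comm (A B : Matrix ι ι K) (p : MvPolynomial (ι × ι) K) :
    conjDerivation A (conjDerivation B p) =
      conjDerivation B (conjDerivation A p) + conjDerivation (A * B - B * A) p := by
  rw [← conjDerivation_commutator, Derivation.commutator_apply]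
  abel

theorem conjDerivation_mem_homogeneousSubmodule (A : Matrix ι ι K) {n : ℕ}
    {p : MvPolynomial (ι × ι) K} (hp : p ∈ MvPolynomial.homogeneousSubmodule (ι × ι) K n) :
    conjDerivation A p ∈ MvPolynomial.homogeneousSubmodule (ι × ι) K n := by
  rw [p.as_sum, map_sum]
  refine sum_mem fun s hs => ?_
  have hd : s.degree = n := by
    rw [Finsupp.degree_eq_weight_one]
    exact hp (MvPolynomial.mem_support_iff.1 hs)
  rw [conjDerivation, MvPolynomial.mkDerivation_monomial]
  refine Submodule.smul_mem _ _ (sum_mem fun q hq => ?_)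
  have h1 : ∀ q : ι × ι, (∑ k, A k q.2 • MvPolynomial.X (q.1, k) -
      ∑ k, A q.1 k • MvPolynomial.X (k, q.2)) ∈ MvPolynomial.homogeneousSubmodule (ι × ι) K 1 :=
    fun q => sub_mem (sum_mem fun k _ => Submodule.smul_mem _ _ (MvPolynomial.isHomogeneous_X _ _))
      (sum_mem fun k _ => Submodule.smul_mem _ _ (MvPolynomial.isHomogeneous_X _ _))
  have h2 : MvPolynomial.IsHomogeneous (MvPolynomial.monomial (s - Finsupp.single q 1) (s q : K))
      (n - 1) := MvPolynomial.isHomogeneous_monomial _ (by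
    have hq' : Finsupp.single q 1 ≤ s := by
      rw [Finsupp.single_le_iff]; exact Nat.one_le_iff_ne_zero.2 (Finsupp.mem_support_iff.1 hq)
    have := congrArg Finsupp.degree (tsub_add_cancel_of_le hq')
    rw [map_add, Finsupp.degree_single, hd] at this
    omega)
  have h3 := h2.mul (h1 q)
  have hn : n - 1 + 1 = n := by
    have := Finsupp.le_degree q s
    have := Nat.one_le_iff_ne_zero.2 (Finsupp.mem_support_iff.1 hq)
    omega
  rwa [hn] at h3

theorem coeff_derivation_of_diagonal {σ : Type*} [Fintype σ] {c : σ → K}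
    {D : Derivation K (MvPolynomial σ K) (MvPolynomial σ K)}
    (hD : ∀ i, D (MvPolynomial.X i) = c i • MvPolynomial.X i) (p : MvPolynomial σ K) (m : σ →₀ ℕ) :
    (D p).coeff m = (∑ i, m i * c i) * p.coeff m := by
  classical
  have hD' : D = MvPolynomial.mkDerivation K fun i => c i • MvPolynomial.X i :=
    MvPolynomial.derivation_ext fun i => by rw [hD, MvPolynomial.mkDerivation_X]
  induction p using MvPolynomial.induction_on' with
  | add p q hp hq => rw [map_add, MvPolynomial.coeff_add, MvPolynomial.coeff_add, hp, hq, mul_add]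
  | monomial s r =>
    have h (i : σ) : MvPolynomial.monomial (s - Finsupp.single i 1) (s i : K) •
        c i • MvPolynomial.X i = MvPolynomial.monomial s (s i * c i) := by
      rw [smul_eq_mul, MvPolynomial.X, MvPolynomial.smul_monomial, MvPolynomial.monomial_mul,
        smul_eq_mul, mul_one]
      by_cases hi : s i = 0
      · simp [hi]
      · rw [tsub_add_cancel_of_le]
        rw [Finsupp.single_le_iff]; exact Nat.one_le_iff_ne_zero.2 hi
    rw [hD', MvPolynomial.mkDerivation_monomial, Finsupp.sum_fintype _ _ (by simp)]
    simp only [h]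
    rw [MvPolynomial.coeff_smul, MvPolynomial.coeff_sum]
    simp only [MvPolynomial.coeff_monomial]
    by_cases hm : s = m <;> simp [hm, mul_comm]

theorem coeff_conjDerivation_diagonal [DecidableEq ι] (d : ι → K) (p : MvPolynomial (ι × ι) K)
    (m : ι × ι →₀ ℕ) :
    (conjDerivation (Matrix.diagonal d) p).coeff m =
      (∑ q, m q * (d q.2 - d q.1)) * p.coeff m :=
  coeff_derivation_of_diagonal (fun q => by
    rw [conjDerivation_X, Finset.sum_eq_single q.2 (by simp +contextual [Matrix.diagonal])
      (by simp), Finset.sum_eq_single q.1 (by simp +contextual [Matrix.diagonal, eq_comm])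
      (by simp), sub_smul]
    simp) p m

end ConjDerivation

section SlTwo

open Module

theorem exists_eq_zero_of_eigenvector_string {K M : Type*} [Field K] [CharZero K] [AddCommGroup M]
    [Module K M] (H : End K M) (P : Submodule K M) [FiniteDimensional K P] (a b : K) (hb : b ≠ 0)
    (v : ℕ → M) (hP : ∀ k, v k ∈ P) (hv : ∀ k, H (v k) = (a + k * b) • v k) :
    ∃ k, v k = 0 := by
  by_contra! h0
  have hli : LinearIndependent K v :=
    End.eigenvectors_linearIndependent' H (fun k : ℕ => a + k * b)
      (fun i j hij => by simpa [hb] using hij) v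
      (fun k => End.hasEigenvector_iff.2 ⟨End.mem_eigenspace_iff.2 (hv k), h0 k⟩)
  have hli' : LinearIndependent K (fun k => (⟨v k, hP k⟩ : P)) :=
    LinearIndependent.of_comp P.subtype hli
  exact not_finite_iff_infinite.2 inferInstance hli'.finite

/-- In a finite-dimensional representation of `sl₂`, the dimension of the invariants is the
difference of the dimensions of the weight spaces of weights `0` and `2`. -/
theorem finrank_sl2_invariants {K M : Type*} [Field K] [CharZero K] [AddCommGroup M]
    [Module K M] (E F H : End K M) (hEF : ∀ v, E (F v) = F (E v) + H v)
    (hHE : ∀ v, H (E v) = E (H v) + (2 : K) • E v)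
    (hHF : ∀ v, H (F v) = F (H v) - (2 : K) • F v)
    (P : Submodule K M) [FiniteDimensional K P] (hE : ∀ v ∈ P, E v ∈ P) (hF : ∀ v ∈ P, F v ∈ P) :
    finrank K ↥(P ⊓ (LinearMap.ker E ⊓ LinearMap.ker F)) + finrank K ↥(P ⊓ End.eigenspace H 2) =
      finrank K ↥(P ⊓ End.eigenspace H 0) := by
  have wE (v : M) (c : K) (hv : H v = c • v) (k : ℕ) :
      H ((E ^ k) v) = (c + k * 2) • (E ^ k) v := by
    induction k with
    | zero => simp [hv]
    | succ k ih =>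
      rw [pow_succ', End.mul_apply, hHE, ih, map_smul, ← add_smul]; congr 1; push_cast; ring
  have wF (v : M) (c : K) (hv : H v = c • v) (k : ℕ) :
      H ((F ^ k) v) = (c + k * (-2)) • (F ^ k) v := by
    induction k with
    | zero => simp [hv]
    | succ k ih =>
      rw [pow_succ', End.mul_apply, hHF, ih, map_smul, ← sub_smul]; congr 1; push_cast; ring
  have pE (v : M) (hv : v ∈ P) (k : ℕ) : (E ^ k) v ∈ P := by
    induction k with
    | zero => simpa
    | succ k ih => rw [pow_succ', End.mul_apply]; exact hE _ ih
  have pF (v : M) (hv : v ∈ P) (k : ℕ) : (F ^ k) v ∈ P := by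
    induction k with
    | zero => simpa
    | succ k ih => rw [pow_succ', End.mul_apply]; exact hF _ ih
  have inj (v : M) (hv : v ∈ P) (h2 : H v = (2 : K) • v) (h0 : E (F v) = 0) : v = 0 := by
    have step (k : ℕ) : F ((E ^ (k + 1)) v) = -(((k : K) + 1) * (k + 2)) • (E ^ k) v := by
      induction k with
      | zero =>
        have := hEF v
        rw [h0, h2] at this
        simp only [zero_add, pow_one, pow_zero, End.one_apply]
        rw [eq_neg_of_add_eq_zero_left this.symm, ← neg_smul]
        congr 1; push_cast; ring
      | succ k ih =>
        have := hEF ((E ^ (k + 1)) v)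
        rw [ih, wE v 2 h2, map_smul, ← End.mul_apply E, ← pow_succ'] at this
        rw [pow_succ', End.mul_apply, ← sub_eq_iff_eq_add.2 this, ← sub_smul]
        congr 1; push_cast; ring
    obtain ⟨k, hk⟩ := exists_eq_zero_of_eigenvector_string H P 2 2 two_ne_zero _ (pE v hv)
      (wE v 2 h2)
    induction k with
    | zero => simpa using hk
    | succ k ih =>
      have := step k
      rw [hk, map_zero, eq_comm, smul_eq_zero] at this
      refine ih (this.resolve_left (neg_ne_zero.2 (mul_ne_zero ?_ ?_)))
      · exact_mod_cast k.succ_ne_zero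
      · exact_mod_cast (k + 1).succ_ne_zero
  have inv (v : M) (hv : v ∈ P) (h0 : H v = 0) (hEv : E v = 0) : F v = 0 := by
    have step (k : ℕ) : E ((F ^ (k + 2)) v) = -(((k : K) + 1) * (k + 2)) • (F ^ (k + 1)) v := by
      induction k with
      | zero =>
        have h1 := hEF v
        rw [hEv, h0, map_zero, add_zero] at h1
        have := hEF (F v)
        rw [h1, hHF, h0, map_zero, zero_add, zero_sub] at this
        simp only [zero_add, pow_succ, pow_zero, one_mul, End.mul_apply]
        rw [this, ← neg_smul]; congr 1; push_cast; ring
      | succ k ih =>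
        have := hEF ((F ^ (k + 2)) v)
        rw [ih, wF v 0 (by simpa using h0), map_smul, ← End.mul_apply F, ← pow_succ',
          ← End.mul_apply F, ← pow_succ', ← add_smul] at this
        rw [this]
        congr 1; push_cast; ring
    obtain ⟨k, hk⟩ := exists_eq_zero_of_eigenvector_string H P (-2) (-2) (by simp)
      (fun k => (F ^ (k + 1)) v) (fun k => pF v hv _) (fun k => by
        rw [wF v 0 (by simpa using h0)]; congr 1; push_cast; ring)
    induction k with
    | zero => simpa using hk
    | succ k ih =>
      have := step k
      rw [hk, map_zero, eq_comm, smul_eq_zero] at this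
      refine ih (this.resolve_left (neg_ne_zero.2 (mul_ne_zero ?_ ?_)))
      · exact_mod_cast k.succ_ne_zero
      · exact_mod_cast (k + 1).succ_ne_zero
  have hE' : ∀ v ∈ P ⊓ End.eigenspace H 0, E v ∈ P ⊓ End.eigenspace H 2 := by
    rintro v ⟨hv, h0⟩
    refine ⟨hE v hv, End.mem_eigenspace_iff.2 ?_⟩
    rw [hHE, End.mem_eigenspace_iff.1 h0]; simp
  have hF' : ∀ v ∈ P ⊓ End.eigenspace H 2, F v ∈ P ⊓ End.eigenspace H 0 := by
    rintro v ⟨hv, h2⟩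
    refine ⟨hF v hv, End.mem_eigenspace_iff.2 ?_⟩
    rw [hHF, End.mem_eigenspace_iff.1 h2]; simp
  let e := E.restrict hE'
  let f := F.restrict hF'
  have : FiniteDimensional K ↥(P ⊓ End.eigenspace H 0) :=
    Submodule.finiteDimensional_of_le inf_le_left
  have : FiniteDimensional K ↥(P ⊓ End.eigenspace H 2) :=
    Submodule.finiteDimensional_of_le inf_le_left
  have hsurj : Function.Surjective e := by
    have : Function.Injective (e ∘ₗ f) := by
      rw [← LinearMap.ker_eq_bot, LinearMap.ker_eq_bot']
      intro v hv
      exact Subtype.ext (inj v v.2.1 (End.mem_eigenspace_iff.1 v.2.2) (congrArg Subtype.val hv))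
    exact Function.Surjective.of_comp (g := f) (LinearMap.injective_iff_surjective.1 this)
  have hker : (LinearMap.ker e).map (Submodule.subtype _) =
      P ⊓ (LinearMap.ker E ⊓ LinearMap.ker F) := by
    ext v
    simp only [Submodule.mem_map, Submodule.subtype_apply, Submodule.mem_inf, LinearMap.mem_ker]
    constructor
    · rintro ⟨w, hw, rfl⟩
      have h1 : E w = 0 := congrArg Subtype.val hw
      exact ⟨w.2.1, h1, inv w w.2.1 (by simpa using End.mem_eigenspace_iff.1 w.2.2) h1⟩
    · rintro ⟨hv, h1, h2⟩
      refine ⟨⟨v, hv, End.mem_eigenspace_iff.2 ?_⟩, Subtype.ext h1, rfl⟩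
      have := hEF v
      rw [h1, h2, map_zero, map_zero, zero_add] at this
      rw [← this, zero_smul]
  rw [← hker, Submodule.finrank_map_subtype_eq, ← e.finrank_range_add_finrank_ker,
    LinearMap.range_eq_top.2 hsurj, finrank_top, add_comm]

end SlTwo

section WeightSpaces

open scoped Kronecker

variable {K : Type*} [Field K]

theorem finrank_restrictSupport {σ : Type*} (s : Set (σ →₀ ℕ)) :
    Module.finrank K (MvPolynomial.restrictSupport K s) = s.ncard :=
  Module.finrank_eq_nat_card_basis (MvPolynomial.basisRestrictSupport K s)

theorem mem_homogeneousSubmodule_iff_coeff {σ : Type*} {n : ℕ} {p : MvPolynomial σ K} :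
    p ∈ MvPolynomial.homogeneousSubmodule σ K n ↔
      ∀ m, p.coeff m ≠ 0 → m.degree = n := by
  simp only [MvPolynomial.mem_homogeneousSubmodule, MvPolynomial.IsHomogeneous,
    MvPolynomial.IsWeightedHomogeneous, Finsupp.degree_eq_weight_one]
  rfl

instance finiteDimensional_homogeneousSubmodule {σ : Type*} [Finite σ] (n : ℕ) :
    FiniteDimensional K (MvPolynomial.homogeneousSubmodule σ K n) := by
  have h : MvPolynomial.homogeneousSubmodule σ K n =
      MvPolynomial.restrictSupport K {m | m.degree = n} := by
    ext p
    rw [mem_homogeneousSubmodule_iff_coeff, MvPolynomial.mem_restrictSupport_iff]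
    simp [Set.subset_def]
  have : Finite {m : σ →₀ ℕ | m.degree = n} := by
    classical
    have := Fintype.ofFinite σ
    refine (Finset.finite_toSet (Finset.univ.finsuppAntidiag n)).subset fun m hm => ?_
    simpa [Finset.mem_finsuppAntidiag, ← Finsupp.degree_eq_sum] using hm
  rw [h]
  exact Module.Finite.of_basis (MvPolynomial.basisRestrictSupport K _)

/-- The infinitesimal conjugation action of matrices acting on the first tensor factor. -/
noncomputable def leftConj (A : Matrix (Fin 2) (Fin 2) K) :
    Module.End K (MvPolynomial ((Fin 2 × Fin 2) × (Fin 2 × Fin 2)) K) :=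
  (conjDerivation (A ⊗ₖ (1 : Matrix (Fin 2) (Fin 2) K))).toLinearMap

/-- The infinitesimal conjugation action of matrices acting on the second tensor factor. -/
noncomputable def rightConj (A : Matrix (Fin 2) (Fin 2) K) :
    Module.End K (MvPolynomial ((Fin 2 × Fin 2) × (Fin 2 × Fin 2)) K) :=
  (conjDerivation ((1 : Matrix (Fin 2) (Fin 2) K) ⊗ₖ A)).toLinearMap

theorem leftConj_apply (A : Matrix (Fin 2) (Fin 2) K)
    (p : MvPolynomial ((Fin 2 × Fin 2) × (Fin 2 × Fin 2)) K) :
    leftConj A p = conjDerivation (A ⊗ₖ (1 : Matrix (Fin 2) (Fin 2) K)) p := rfl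

theorem rightConj_apply (A : Matrix (Fin 2) (Fin 2) K)
    (p : MvPolynomial ((Fin 2 × Fin 2) × (Fin 2 × Fin 2)) K) :
    rightConj A p = conjDerivation ((1 : Matrix (Fin 2) (Fin 2) K) ⊗ₖ A) p := rfl

theorem sub_kronecker {l m n o : Type*} (A B : Matrix l m K) (C : Matrix n o K) :
    (A - B) ⊗ₖ C = A ⊗ₖ C - B ⊗ₖ C := by
  ext; simp [sub_mul]

theorem kronecker_sub {l m n o : Type*} (A : Matrix l m K) (B C : Matrix n o K) :
    A ⊗ₖ (B - C) = A ⊗ₖ B - A ⊗ₖ C := by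
  ext; simp [mul_sub]

theorem leftConj_comm (A B : Matrix (Fin 2) (Fin 2) K)
    (p : MvPolynomial ((Fin 2 × Fin 2) × (Fin 2 × Fin 2)) K) :
    leftConj A (leftConj B p) = leftConj B (leftConj A p) + leftConj (A * B - B * A) p := by
  simp only [leftConj_apply]
  rw [conjDerivation_comm, ← Matrix.mul_kronecker_mul, ← Matrix.mul_kronecker_mul,
    mul_one, ← sub_kronecker]

theorem rightConj_comm (A B : Matrix (Fin 2) (Fin 2) K)
    (p : MvPolynomial ((Fin 2 × Fin 2) × (Fin 2 × Fin 2)) K) :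
    rightConj A (rightConj B p) = rightConj B (rightConj A p) + rightConj (A * B - B * A) p := by
  simp only [rightConj_apply]
  rw [conjDerivation_comm, ← Matrix.mul_kronecker_mul, ← Matrix.mul_kronecker_mul,
    mul_one, ← kronecker_sub]

theorem leftConj_rightConj (A B : Matrix (Fin 2) (Fin 2) K)
    (p : MvPolynomial ((Fin 2 × Fin 2) × (Fin 2 × Fin 2)) K) :
    leftConj A (rightConj B p) = rightConj B (leftConj A p) := by
  simp only [leftConj_apply, rightConj_apply]
  rw [conjDerivation_comm, ← Matrix.mul_kronecker_mul, ← Matrix.mul_kronecker_mul, mul_one,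
    mul_one, one_mul, one_mul, sub_self, conjDerivation_zero, Derivation.zero_apply, add_zero]

theorem leftConj_smul (c : K) (A : Matrix (Fin 2) (Fin 2) K)
    (p : MvPolynomial ((Fin 2 × Fin 2) × (Fin 2 × Fin 2)) K) :
    leftConj (c • A) p = c • leftConj A p := by
  rw [leftConj_apply, Matrix.smul_kronecker, conjDerivation_smul]; rfl

theorem rightConj_smul (c : K) (A : Matrix (Fin 2) (Fin 2) K)
    (p : MvPolynomial ((Fin 2 × Fin 2) × (Fin 2 × Fin 2)) K) :
    rightConj (c • A) p = c • rightConj A p := by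
  rw [rightConj_apply, Matrix.kronecker_smul, conjDerivation_smul]; rfl

theorem coeff_leftConj_diagonal (p : MvPolynomial ((Fin 2 × Fin 2) × (Fin 2 × Fin 2)) K)
    (m : (Fin 2 × Fin 2) × (Fin 2 × Fin 2) →₀ ℕ) :
    (leftConj !![1, 0; 0, -1] p).coeff m =
      ((2 * (∑ q, m q • endWeight q).1 : ℤ) : K) * p.coeff m := by
  have h : !![1, 0; 0, -1] ⊗ₖ (1 : Matrix (Fin 2) (Fin 2) K) =
      Matrix.diagonal fun i : Fin 2 × Fin 2 => 1 - 2 * (((i.1 : ℕ) : ℤ) : K) := by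
    ext i j
    fin_cases i <;> fin_cases j <;> norm_num [Matrix.one_apply]
  rw [leftConj_apply, h, coeff_conjDerivation_diagonal]
  congr 1
  rw [Prod.fst_sum, Finset.mul_sum, Int.cast_sum]
  refine Finset.sum_congr rfl fun q _ => ?_
  simp [endWeight]
  ring

theorem coeff_rightConj_diagonal (p : MvPolynomial ((Fin 2 × Fin 2) × (Fin 2 × Fin 2)) K)
    (m : (Fin 2 × Fin 2) × (Fin 2 × Fin 2) →₀ ℕ) :
    (rightConj !![1, 0; 0, -1] p).coeff m =
      ((2 * (∑ q, m q • endWeight q).2 : ℤ) : K) * p.coeff m := by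
  have h : (1 : Matrix (Fin 2) (Fin 2) K) ⊗ₖ !![1, 0; 0, -1] =
      Matrix.diagonal fun i : Fin 2 × Fin 2 => 1 - 2 * (((i.2 : ℕ) : ℤ) : K) := by
    ext i j
    fin_cases i <;> fin_cases j <;> norm_num [Matrix.one_apply]
  rw [rightConj_apply, h, coeff_conjDerivation_diagonal]
  congr 1
  rw [Prod.snd_sum, Finset.mul_sum, Int.cast_sum]
  refine Finset.sum_congr rfl fun q _ => ?_
  simp [endWeight]
  ring

theorem mem_filter_finsuppAntidiag {σ : Type*} [Fintype σ] [DecidableEq σ] {wt : σ → ℤ × ℤ} {n : ℕ}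
    {s : ℤ × ℤ} {m : σ →₀ ℕ} :
    m ∈ (Finset.univ.finsuppAntidiag n).filter (fun l : σ →₀ ℕ => ∑ i, l i • wt i = s) ↔
      m.degree = n ∧ ∑ i, m i • wt i = s := by
  simp [Finset.mem_finsuppAntidiag, Finsupp.degree_eq_sum]

theorem finrank_weightSpace [CharZero K] (n : ℕ) (a b : ℤ) (a' b' : K) (ha : a' = (2 * a : ℤ))
    (hb : b' = (2 * b : ℤ)) :
    Module.finrank K ↥(MvPolynomial.homogeneousSubmodule ((Fin 2 × Fin 2) × (Fin 2 × Fin 2)) K n ⊓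
      Module.End.eigenspace (rightConj !![1, 0; 0, -1]) b' ⊓
      Module.End.eigenspace (leftConj !![1, 0; 0, -1]) a') = monomialCount endWeight n (a, b) := by
  have h : MvPolynomial.homogeneousSubmodule ((Fin 2 × Fin 2) × (Fin 2 × Fin 2)) K n ⊓
      Module.End.eigenspace (rightConj !![1, 0; 0, -1]) b' ⊓
      Module.End.eigenspace (leftConj !![1, 0; 0, -1]) a' =
      MvPolynomial.restrictSupport K ↑((Finset.univ.finsuppAntidiag n).filter
        fun l : ((Fin 2 × Fin 2) × (Fin 2 × Fin 2)) →₀ ℕ => ∑ i, l i • endWeight i = (a, b)) := by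
    ext p
    rw [Submodule.mem_inf, Submodule.mem_inf, mem_homogeneousSubmodule_iff_coeff,
      MvPolynomial.mem_restrictSupport_iff, Module.End.mem_eigenspace_iff,
      Module.End.mem_eigenspace_iff, MvPolynomial.ext_iff, MvPolynomial.ext_iff, Set.subset_def]
    simp only [coeff_leftConj_diagonal, coeff_rightConj_diagonal, MvPolynomial.coeff_smul,
      smul_eq_mul, ← forall_and, ha, hb]
    refine forall_congr' fun m => ?_
    have hd : m ∈ (Finset.univ.finsuppAntidiag n).filter (fun l => ∑ i, l i • endWeight i = (a, b))
        ↔ (m.degree = n ∧ (∑ i, m i • endWeight i).2 = b) ∧ (∑ i, m i • endWeight i).1 = a := by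
      rw [mem_filter_finsuppAntidiag, Prod.ext_iff, and_assoc, and_comm (a := _ = a)]
    rw [Finset.mem_coe, Finset.mem_coe, MvPolynomial.mem_support_iff, hd]
    generalize ∑ i, m i • endWeight i = t
    by_cases hm : p.coeff m = 0
    · simp [hm]
    · rw [mul_left_inj' hm, mul_left_inj' hm, Int.cast_inj, Int.cast_inj]
      simp [hm]
  rw [h, finrank_restrictSupport, Set.ncard_coe_finset, monomialCount]

theorem finrank_conj_invariants [CharZero K] (n : ℕ) :
    (Module.finrank K ↥(MvPolynomial.homogeneousSubmodule ((Fin 2 × Fin 2) × (Fin 2 × Fin 2)) K n ⊓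
        (LinearMap.ker (leftConj !![0, 1; 0, 0]) ⊓ LinearMap.ker (leftConj !![0, 0; 1, 0])) ⊓
        (LinearMap.ker (rightConj !![0, 1; 0, 0]) ⊓
          LinearMap.ker (rightConj !![0, 0; 1, 0]))) : ℤ) =
      monomialCount endWeight n (0, 0) - monomialCount endWeight n (1, 0) -
        monomialCount endWeight n (0, 1) + monomialCount endWeight n (1, 1) := by
  have hef : (!![0, 1; 0, 0] * !![0, 0; 1, 0] - !![0, 0; 1, 0] * !![0, 1; 0, 0] :
      Matrix (Fin 2) (Fin 2) K) = !![1, 0; 0, -1] := by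
    ext i j; fin_cases i <;> fin_cases j <;> simp
  have hhe : (!![1, 0; 0, -1] * !![0, 1; 0, 0] - !![0, 1; 0, 0] * !![1, 0; 0, -1] :
      Matrix (Fin 2) (Fin 2) K) = (2 : K) • !![0, 1; 0, 0] := by
    ext i j; fin_cases i <;> fin_cases j <;> norm_num [Matrix.mul_apply, Fin.sum_univ_two]
  have hhf : (!![1, 0; 0, -1] * !![0, 0; 1, 0] - !![0, 0; 1, 0] * !![1, 0; 0, -1] :
      Matrix (Fin 2) (Fin 2) K) = (-2 : K) • !![0, 0; 1, 0] := by
    ext i j; fin_cases i <;> fin_cases j <;> norm_num [Matrix.mul_apply, Fin.sum_univ_two]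
  set P := MvPolynomial.homogeneousSubmodule ((Fin 2 × Fin 2) × (Fin 2 × Fin 2)) K n with hP
  have hPl (A : Matrix (Fin 2) (Fin 2) K) : ∀ p ∈ P, leftConj A p ∈ P :=
    fun p hp => conjDerivation_mem_homogeneousSubmodule _ hp
  have hPr (A : Matrix (Fin 2) (Fin 2) K) : ∀ p ∈ P, rightConj A p ∈ P :=
    fun p hp => conjDerivation_mem_homogeneousSubmodule _ hp
  have key (c : K) := finrank_sl2_invariants (leftConj !![0, 1; 0, 0]) (leftConj !![0, 0; 1, 0])
    (leftConj !![1, 0; 0, -1]) (fun p => by rw [leftConj_comm, hef])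
    (fun p => by rw [leftConj_comm, hhe, leftConj_smul])
    (fun p => by rw [leftConj_comm, hhf, leftConj_smul, neg_smul, sub_eq_add_neg])
    (P ⊓ Module.End.eigenspace (rightConj !![1, 0; 0, -1]) c)
    (fun p hp => ⟨hPl _ p hp.1, Module.End.mem_eigenspace_iff.2 (by
      rw [← leftConj_rightConj, Module.End.mem_eigenspace_iff.1 hp.2, map_smul])⟩)
    (fun p hp => ⟨hPl _ p hp.1, Module.End.mem_eigenspace_iff.2 (by
      rw [← leftConj_rightConj, Module.End.mem_eigenspace_iff.1 hp.2, map_smul])⟩)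
  have key' := finrank_sl2_invariants (rightConj !![0, 1; 0, 0]) (rightConj !![0, 0; 1, 0])
    (rightConj !![1, 0; 0, -1]) (fun p => by rw [rightConj_comm, hef])
    (fun p => by rw [rightConj_comm, hhe, rightConj_smul])
    (fun p => by rw [rightConj_comm, hhf, rightConj_smul, neg_smul, sub_eq_add_neg])
    (P ⊓ (LinearMap.ker (leftConj !![0, 1; 0, 0]) ⊓ LinearMap.ker (leftConj !![0, 0; 1, 0])))
    (fun p hp => ⟨hPr _ p hp.1, LinearMap.mem_ker.2 (by
      rw [leftConj_rightConj, LinearMap.mem_ker.1 hp.2.1, map_zero]), LinearMap.mem_ker.2 (by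
      rw [leftConj_rightConj, LinearMap.mem_ker.1 hp.2.2, map_zero])⟩)
    (fun p hp => ⟨hPr _ p hp.1, LinearMap.mem_ker.2 (by
      rw [leftConj_rightConj, LinearMap.mem_ker.1 hp.2.1, map_zero]), LinearMap.mem_ker.2 (by
      rw [leftConj_rightConj, LinearMap.mem_ker.1 hp.2.2, map_zero])⟩)
  rw [inf_right_comm P _ (Module.End.eigenspace _ 2),
    inf_right_comm P _ (Module.End.eigenspace _ 0)] at key'
  have k0 := key 0
  have k2 := key 2
  rw [finrank_weightSpace n 0 0 0 0 (by simp) (by simp),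
    finrank_weightSpace n 1 0 2 0 (by simp) (by simp)] at k0
  rw [finrank_weightSpace n 0 1 0 2 (by simp) (by simp),
    finrank_weightSpace n 1 1 2 2 (by simp) (by simp)] at k2
  omega

end WeightSpaces

section MatrixInvariants

variable {ι K : Type*} [Field K]

/-- The value of a polynomial in the matrix entries at a matrix. -/
noncomputable def matrixEval (u : Matrix ι ι K) : MvPolynomial (ι × ι) K →ₐ[K] K :=
  MvPolynomial.aeval fun q => u q.1 q.2

theorem matrixEval_X (u : Matrix ι ι K) (q : ι × ι) :
    matrixEval u (MvPolynomial.X q) = u q.1 q.2 :=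
  MvPolynomial.aeval_X _ _

theorem matrixEval_eq_zero_iff [Infinite K] {p : MvPolynomial (ι × ι) K} :
    (∀ u, matrixEval u p = 0) ↔ p = 0 := by
  refine ⟨fun h => MvPolynomial.funext fun x => ?_, fun h u => by rw [h, map_zero]⟩
  rw [map_zero, ← MvPolynomial.coe_aeval_eq_eval]
  exact h (Matrix.of fun i j => x (i, j))

variable [Fintype ι]

/-- Restriction of polynomials to the curve `s ↦ (1 + s A) u (1 - s A)`. -/
noncomputable def restrictCurve (A u : Matrix ι ι K) :
    MvPolynomial (ι × ι) K →ₐ[K] Polynomial K :=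
  MvPolynomial.aeval fun q => Polynomial.C (u q.1 q.2) +
    Polynomial.X * Polynomial.C ((A * u - u * A) q.1 q.2) -
    Polynomial.X ^ 2 * Polynomial.C ((A * u * A) q.1 q.2)

theorem eval_restrictCurve [DecidableEq ι] (A u : Matrix ι ι K) (s : K)
    (p : MvPolynomial (ι × ι) K) :
    (restrictCurve A u p).eval s = matrixEval ((1 + s • A) * u * (1 - s • A)) p := by
  have h : (Polynomial.aeval s).comp (restrictCurve A u) =
      matrixEval ((1 + s • A) * u * (1 - s • A)) := by
    refine MvPolynomial.algHom_ext fun q => ?_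
    have hm : (1 + s • A) * u * (1 - s • A) = u + s • (A * u - u * A) - s ^ 2 • (A * u * A) := by
      simp only [add_mul, mul_sub, mul_one, one_mul, smul_mul_assoc, mul_smul_comm, smul_sub,
        smul_add, smul_smul, pow_two, Matrix.mul_assoc]
      abel
    rw [matrixEval_X, hm]
    simp [restrictCurve]
    ring
  rw [← h]
  simp [Polynomial.coe_aeval_eq_eval]

theorem derivative_restrictCurve {A : Matrix ι ι K} (hA : A * A = 0) (u : Matrix ι ι K)
    (p : MvPolynomial (ι × ι) K) :
    Polynomial.derivative (restrictCurve A u p) = -restrictCurve A u (conjDerivation A p) := by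
  induction p using MvPolynomial.induction_on with
  | C a => simp [restrictCurve, MvPolynomial.derivation_C]
  | add p q hp hq => simp [hp, hq, add_comm]
  | mul_X p q hp =>
    have hX : Polynomial.derivative (restrictCurve A u (MvPolynomial.X q)) =
        -restrictCurve A u (conjDerivation A (MvPolynomial.X q)) := by
      have h1 (M : Matrix ι ι K) : ∑ k, A k q.2 • Polynomial.C (M q.1 k) =
          Polynomial.C ((M * A) q.1 q.2) := by
        simp [Matrix.mul_apply, Polynomial.smul_eq_C_mul, mul_comm]
      have h2 (M : Matrix ι ι K) : ∑ k, A q.1 k • Polynomial.C (M k q.2) =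
          Polynomial.C ((A * M) q.1 q.2) := by
        simp [Matrix.mul_apply, Polynomial.smul_eq_C_mul]
      have h3 (M : Matrix ι ι K) : M * A * A = 0 := by rw [Matrix.mul_assoc, hA, Matrix.mul_zero]
      rw [conjDerivation_X]
      simp only [restrictCurve, map_sub, map_sum, map_smul, MvPolynomial.aeval_X, smul_sub,
        smul_add, Finset.sum_add_distrib, Finset.sum_sub_distrib, ← mul_smul_comm, ← Finset.mul_sum]
      simp only [← map_sub, h1, h2, Matrix.sub_mul, Matrix.mul_sub, h3,
        ← Matrix.mul_assoc, hA, Matrix.zero_mul]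
      simp
      ring
    rw [map_mul, Polynomial.derivative_mul, hp, hX, Derivation.leibniz, map_add, smul_eq_mul,
      smul_eq_mul, map_mul, map_mul]
    ring

variable [DecidableEq ι]

theorem conjDerivation_eq_zero_iff [CharZero K] {A : Matrix ι ι K} (hA : A * A = 0)
    {p : MvPolynomial (ι × ι) K} :
    conjDerivation A p = 0 ↔
      ∀ (s : K) (u : Matrix ι ι K), matrixEval ((1 + s • A) * u * (1 - s • A)) p =
        matrixEval u p := by
  have h0 (u : Matrix ι ι K) (q : MvPolynomial (ι × ι) K) :
      (restrictCurve A u q).eval 0 = matrixEval u q := by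
    simp [eval_restrictCurve]
  refine ⟨fun h s u => ?_, fun h => matrixEval_eq_zero_iff.1 fun u => ?_⟩
  · have hd := derivative_restrictCurve hA u p
    rw [h, map_zero, neg_zero] at hd
    have hc := Polynomial.eq_C_of_natDegree_eq_zero
      (Polynomial.derivative_eq_zero.1 hd)
    rw [← eval_restrictCurve, ← h0, hc, Polynomial.eval_C, Polynomial.eval_C]
  · have hc : restrictCurve A u p = Polynomial.C (matrixEval u p) :=
      Polynomial.funext fun s => by rw [eval_restrictCurve, h, Polynomial.eval_C]
    have hd := derivative_restrictCurve hA u p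
    rw [hc, Polynomial.derivative_C, eq_comm, neg_eq_zero] at hd
    rw [← h0, hd, Polynomial.eval_zero]

theorem matrixEval_conj_diagonal [CharZero K] {d : ι → Fin 2} {p : MvPolynomial (ι × ι) K}
    (hp : conjDerivation (Matrix.diagonal fun i => ![1, -1] (d i)) p = 0) {c : Fin 2 → K}
    (hc : ∀ i, c i ≠ 0) (u : Matrix ι ι K) :
    matrixEval (Matrix.diagonal (fun i => c (d i)) * u *
      Matrix.diagonal (fun i => (c (d i))⁻¹)) p = matrixEval u p := by
  have hq (i j : Fin 2) : c i * (c j)⁻¹ = (c 1 / c 0) ^ ((i : ℤ) - (j : ℤ)) := by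
    have h0 := hc 0
    have h1 := hc 1
    fin_cases i <;> fin_cases j <;> simp [h0, h1, div_eq_mul_inv, mul_comm]
  rw [matrixEval, matrixEval, MvPolynomial.aeval_def, MvPolynomial.aeval_def,
    MvPolynomial.eval₂_eq', MvPolynomial.eval₂_eq']
  refine Finset.sum_congr rfl fun m hm => ?_
  have hw : ∑ q, (m q : ℤ) * ((d q.1 : ℤ) - (d q.2 : ℤ)) = 0 := by
    have h := congrArg (MvPolynomial.coeff m) hp
    rw [coeff_conjDerivation_diagonal, MvPolynomial.coeff_zero, mul_eq_zero,
      or_iff_left (MvPolynomial.mem_support_iff.1 hm)] at h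
    have h2 (i : Fin 2) : (![1, -1] i : K) = 1 - 2 * ((i : ℕ) : K) := by
      fin_cases i <;> norm_num
    have h3 : (2 : K) * ((∑ q, (m q : ℤ) * ((d q.1 : ℤ) - (d q.2 : ℤ)) : ℤ) : K) = 0 := by
      rw [← h, Int.cast_sum, Finset.mul_sum]
      refine Finset.sum_congr rfl fun q _ => ?_
      rw [h2, h2]
      push_cast
      ring
    exact_mod_cast (mul_eq_zero.1 h3).resolve_left two_ne_zero
  congr 1
  have hr : c 1 / c 0 ≠ 0 := div_ne_zero (hc 1) (hc 0)
  have he (q : ι × ι) : (Matrix.diagonal (fun i => c (d i)) * u *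
      Matrix.diagonal (fun i => (c (d i))⁻¹)) q.1 q.2 ^ m q =
      (c 1 / c 0) ^ ((m q : ℤ) * ((d q.1 : ℤ) - (d q.2 : ℤ))) * u q.1 q.2 ^ m q := by
    rw [Matrix.mul_diagonal, Matrix.diagonal_mul, mul_right_comm, hq, mul_pow, mul_comm (m q : ℤ),
      zpow_mul, zpow_natCast]
  have hz (f : ι × ι → ℤ) : ∏ q, (c 1 / c 0) ^ f q = (c 1 / c 0) ^ ∑ q, f q := by
    induction (Finset.univ : Finset (ι × ι)) using Finset.induction_on with
    | empty => simp
    | insert q s hs ih => rw [Finset.prod_insert hs, Finset.sum_insert hs, ih, zpow_add₀ hr]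
  simp only [he]
  rw [Finset.prod_mul_distrib, hz, hw, zpow_zero, one_mul]

theorem matrixEval_conj_iff [CharZero K] (T : Matrix (Fin 2) (Fin 2) K →ₐ[K] Matrix ι ι K)
    (d : ι → Fin 2) (hT : ∀ c, T (Matrix.diagonal c) = Matrix.diagonal fun i => c (d i))
    {p : MvPolynomial (ι × ι) K} :
    conjDerivation (T !![0, 1; 0, 0]) p = 0 ∧ conjDerivation (T !![0, 0; 1, 0]) p = 0 ↔
      ∀ g : Matrix (Fin 2) (Fin 2) K, g.det ≠ 0 → ∀ u,
        matrixEval (T g * u * T g⁻¹) p = matrixEval u p := by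
  have he : (!![0, 1; 0, 0] * !![0, 1; 0, 0] : Matrix (Fin 2) (Fin 2) K) = 0 := by
    ext i j; fin_cases i <;> fin_cases j <;> simp [Matrix.mul_apply]
  have hf : (!![0, 0; 1, 0] * !![0, 0; 1, 0] : Matrix (Fin 2) (Fin 2) K) = 0 := by
    ext i j; fin_cases i <;> fin_cases j <;> simp [Matrix.mul_apply]
  have hinv {A : Matrix (Fin 2) (Fin 2) K} (hA : A * A = 0) (s : K) :
      (1 + s • A) * (1 - s • A) = 1 := by
    simp [add_mul, mul_sub, hA]
  have hTsq {A : Matrix (Fin 2) (Fin 2) K} (hA : A * A = 0) : T A * T A = 0 := by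
    rw [← map_mul, hA, map_zero]
  have hconj {A : Matrix (Fin 2) (Fin 2) K} (hA : A * A = 0) (s : K) (u : Matrix ι ι K) :
      T (1 + s • A) * u * T (1 + s • A)⁻¹ = (1 + s • T A) * u * (1 - s • T A) := by
    rw [Matrix.inv_eq_right_inv (hinv hA s), map_add, map_sub, map_smul, map_one]
  constructor
  · rintro ⟨h1, h2⟩ g hg
    refine Matrix.diagonal_transvection_induction_of_det_ne_zero (fun g => ∀ u,
      matrixEval (T g * u * T g⁻¹) p = matrixEval u p) g hg (fun c hc u => ?_) (fun t u => ?_)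
      (fun A B _ _ ihA ihB u => ?_)
    · have hc' : ∀ i, c i ≠ 0 := by
        simpa [Matrix.det_diagonal, Finset.prod_ne_zero_iff] using hc
      have hH : conjDerivation (Matrix.diagonal fun i => ![1, -1] (d i)) p = 0 := by
        have hc := conjDerivation_comm (T !![0, 1; 0, 0]) (T !![0, 0; 1, 0]) p
        rw [h1, h2, map_zero, map_zero, zero_add, ← map_mul T, ← map_mul T, ← map_sub T] at hc
        rw [hc, ← hT]
        congr 3
        ext i j; fin_cases i <;> fin_cases j <;> simp
      have hi : (Matrix.diagonal c)⁻¹ = Matrix.diagonal fun i => (c i)⁻¹ :=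
        Matrix.inv_eq_right_inv (by
          rw [Matrix.diagonal_mul_diagonal, ← Matrix.diagonal_one]
          simp [hc'])
      rw [hi, hT, hT]
      exact matrixEval_conj_diagonal hH hc' u
    · obtain ⟨i, j, hij, c⟩ := t
      rw [Matrix.TransvectionStruct.toMatrix_mk, Matrix.transvection]
      have hs : (i = 0 ∧ j = 1) ∨ (i = 1 ∧ j = 0) := by omega
      rcases hs with ⟨rfl, rfl⟩ | ⟨rfl, rfl⟩
      · have : Matrix.single 0 1 c = c • !![0, 1; 0, 0] := by
          ext i j; fin_cases i <;> fin_cases j <;> simp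
        rw [this, hconj he]
        exact (conjDerivation_eq_zero_iff (hTsq he)).1 h1 c u
      · have : Matrix.single 1 0 c = c • !![0, 0; 1, 0] := by
          ext i j; fin_cases i <;> fin_cases j <;> simp
        rw [this, hconj hf]
        exact (conjDerivation_eq_zero_iff (hTsq hf)).1 h2 c u
    · rw [Matrix.mul_inv_rev, map_mul, map_mul, ← ihB u, ← ihA (T B * u * T B⁻¹)]
      simp only [Matrix.mul_assoc]
  · intro h
    have key {A : Matrix (Fin 2) (Fin 2) K} (hA : A * A = 0) : conjDerivation (T A) p = 0 := by
      refine (conjDerivation_eq_zero_iff (hTsq hA)).2 fun s u => ?_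
      rw [← hconj hA]
      refine h _ (fun h0 => ?_) u
      have := congrArg Matrix.det (hinv hA s)
      rw [Matrix.det_mul, h0, zero_mul, Matrix.det_one] at this
      exact zero_ne_one this
    exact ⟨key he, key hf⟩

end MatrixInvariants

section KroneckerInvariants

open scoped Kronecker

variable {K : Type*} [Field K]

/-- The embedding `A ↦ A ⊗ 1` of matrix algebras. -/
noncomputable def kroneckerOne : Matrix (Fin 2) (Fin 2) K →ₐ[K]
    Matrix (Fin 2 × Fin 2) (Fin 2 × Fin 2) K :=
  AlgHom.ofLinearMap
    { toFun := fun A => A ⊗ₖ (1 : Matrix (Fin 2) (Fin 2) K)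
      map_add' := fun A B => Matrix.add_kronecker A B 1
      map_smul' := fun c A => Matrix.smul_kronecker c A 1 }
    Matrix.one_kronecker_one fun A B => by
      change _ ⊗ₖ _ = (_ ⊗ₖ _) * (_ ⊗ₖ _)
      rw [← Matrix.mul_kronecker_mul, mul_one]

/-- The embedding `A ↦ 1 ⊗ A` of matrix algebras. -/
noncomputable def oneKronecker : Matrix (Fin 2) (Fin 2) K →ₐ[K]
    Matrix (Fin 2 × Fin 2) (Fin 2 × Fin 2) K :=
  AlgHom.ofLinearMap
    { toFun := fun A => (1 : Matrix (Fin 2) (Fin 2) K) ⊗ₖ A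
      map_add' := fun A B => Matrix.kronecker_add 1 A B
      map_smul' := fun c A => Matrix.kronecker_smul c 1 A }
    Matrix.one_kronecker_one fun A B => by
      change _ ⊗ₖ _ = (_ ⊗ₖ _) * (_ ⊗ₖ _)
      rw [← Matrix.mul_kronecker_mul, mul_one]

theorem kroneckerOne_apply (A : Matrix (Fin 2) (Fin 2) K) :
    kroneckerOne A = A ⊗ₖ (1 : Matrix (Fin 2) (Fin 2) K) := rfl

theorem oneKronecker_apply (A : Matrix (Fin 2) (Fin 2) K) :
    oneKronecker A = (1 : Matrix (Fin 2) (Fin 2) K) ⊗ₖ A := rfl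

theorem matrixEval_kronecker_conj_iff [CharZero K]
    {p : MvPolynomial ((Fin 2 × Fin 2) × (Fin 2 × Fin 2)) K} :
    p ∈ (LinearMap.ker (leftConj !![0, 1; 0, 0]) ⊓ LinearMap.ker (leftConj !![0, 0; 1, 0])) ⊓
        (LinearMap.ker (rightConj !![0, 1; 0, 0]) ⊓ LinearMap.ker (rightConj !![0, 0; 1, 0])) ↔
      ∀ g h : Matrix (Fin 2) (Fin 2) K, g.det ≠ 0 → h.det ≠ 0 → ∀ u,
        matrixEval ((g ⊗ₖ h) * u * (g⁻¹ ⊗ₖ h⁻¹)) p = matrixEval u p := by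
  have hL := matrixEval_conj_iff kroneckerOne Prod.fst (p := p) fun c => by
    rw [kroneckerOne_apply, ← Matrix.diagonal_one, Matrix.diagonal_kronecker_diagonal]
    simp
  have hR := matrixEval_conj_iff oneKronecker Prod.snd (p := p) fun c => by
    rw [oneKronecker_apply, ← Matrix.diagonal_one, Matrix.diagonal_kronecker_diagonal]
    simp
  have hLR (g h : Matrix (Fin 2) (Fin 2) K) : g ⊗ₖ h = kroneckerOne g * oneKronecker h := by
    rw [kroneckerOne_apply, oneKronecker_apply, ← Matrix.mul_kronecker_mul, mul_one, one_mul]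
  have hRL (g h : Matrix (Fin 2) (Fin 2) K) : g ⊗ₖ h = oneKronecker h * kroneckerOne g := by
    rw [kroneckerOne_apply, oneKronecker_apply, ← Matrix.mul_kronecker_mul, mul_one, one_mul]
  refine (and_congr hL hR).trans ⟨fun ⟨h1, h2⟩ g h hg hh u => ?_, fun H => ⟨fun g hg u => ?_,
    fun h hh u => ?_⟩⟩
  · rw [← h2 h hh u, ← h1 g hg (oneKronecker h * u * oneKronecker h⁻¹), hLR, hRL]
    simp only [Matrix.mul_assoc]
  · have := H g 1 hg (by simp) u
    rwa [inv_one] at this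
  · have := H 1 h (by simp) hh u
    rwa [inv_one] at this

end KroneckerInvariants

section MultilinearForms

variable {K : Type*} [Field K] {U σ : Type*} [AddCommGroup U] [Module K U]

theorem exists_multilinear_iff_exists_homogeneous [Fintype σ] (c : Module.Basis σ K U) (n : ℕ)
    (F : U → K) :
    (∃ m : MultilinearMap K (fun _ : Fin n => U) K, ∀ u, F u = m fun _ => u) ↔
      ∃ p ∈ MvPolynomial.homogeneousSubmodule σ K n,
        ∀ u, F u = MvPolynomial.aeval (fun i => c.repr u i) p := by
  classical
  constructor
  · rintro ⟨m, hm⟩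
    refine ⟨∑ r : Fin n → σ, m (fun i => c (r i)) • ∏ i, MvPolynomial.X (r i),
      sum_mem fun r _ => Submodule.smul_mem _ _ ?_, fun u => ?_⟩
    · rw [MvPolynomial.mem_homogeneousSubmodule]
      simpa using MvPolynomial.IsHomogeneous.prod Finset.univ
        (fun i => (MvPolynomial.X (r i) : MvPolynomial σ K)) (fun _ => 1)
        fun i _ => MvPolynomial.isHomogeneous_X _ _
    · rw [hm, map_sum]
      conv_lhs => rw [← c.sum_repr u]
      rw [m.map_sum]
      refine Finset.sum_congr rfl fun r _ => ?_
      rw [m.map_smul_univ, map_smul, map_prod, smul_eq_mul, smul_eq_mul, mul_comm]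
      simp
  · rintro ⟨p, hp, hF⟩
    have h (s : σ →₀ ℕ) (hs : s ∈ p.support) :
        ∃ m : MultilinearMap K (fun _ : Fin n => U) K, ∀ u,
          MvPolynomial.aeval (fun i => c.repr u i) (MvPolynomial.monomial s (p.coeff s)) =
            m fun _ => u := by
      have hd : s.degree = n :=
        mem_homogeneousSubmodule_iff_coeff.1 hp s (MvPolynomial.mem_support_iff.1 hs)
      obtain ⟨l, hl⟩ := Quotient.exists_rep (Finsupp.toMultiset s)
      have hlen : l.length = n := by
        rw [← hd]
        exact (congrArg Multiset.card hl).trans (Finsupp.card_toMultiset s)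
      subst hlen
      refine ⟨p.coeff s • (MultilinearMap.mkPiAlgebra K (Fin l.length) K).compLinearMap
        fun i => c.coord (l.get i), fun u => ?_⟩
      have hprod : s.prod (fun i k => c.repr u i ^ k) = (l.map fun i => c.repr u i).prod := by
        have : (l.map fun i => c.repr u i).prod =
            ((Finsupp.toMultiset s).map fun i => c.repr u i).prod := by
          rw [← hl]
          simp
        rw [this, Finsupp.toMultiset_map, Finsupp.prod_toMultiset, Finsupp.prod_mapDomain_index]
        all_goals simp [pow_add]
      rw [MvPolynomial.aeval_monomial, hprod, ← List.ofFn_getElem_eq_map, List.prod_ofFn]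
      simp
    choose! m hm using h
    refine ⟨∑ s ∈ p.support, m s, fun u => ?_⟩
    rw [hF, sum_apply]
    conv_lhs => rw [p.as_sum, map_sum]
    exact Finset.sum_congr rfl fun s hs => hm s hs u

end MultilinearForms

section TensorInvariants

variable {K : Type} [Field K] {V W : Type} [AddCommGroup V] [Module K V] [AddCommGroup W]
  [Module K W]

open scoped Kronecker

theorem toMatrix_tensorConjAction {κ : Type*} [Fintype κ] [DecidableEq κ] (bV : Module.Basis κ K V)
    (bW : Module.Basis κ K W) (γ : (V ≃ₗ[K] V) × (W ≃ₗ[K] W))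
    (φ : TensorProduct K V W →ₗ[K] TensorProduct K V W) :
    LinearMap.toMatrix (bV.tensorProduct bW) (bV.tensorProduct bW) (tensorConjAction K V W γ φ) =
      (LinearMap.toMatrix bV bV γ.1 ⊗ₖ LinearMap.toMatrix bW bW γ.2) *
        LinearMap.toMatrix (bV.tensorProduct bW) (bV.tensorProduct bW) φ *
        ((LinearMap.toMatrix bV bV γ.1)⁻¹ ⊗ₖ (LinearMap.toMatrix bW bW γ.2)⁻¹) := by
  have hinv {M : Type} [AddCommGroup M] [Module K M] (b : Module.Basis κ K M) (e : M ≃ₗ[K] M) :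
      (LinearMap.toMatrix b b e.toLinearMap)⁻¹ = LinearMap.toMatrix b b e.symm.toLinearMap := by
    refine Matrix.inv_eq_right_inv ?_
    rw [← LinearMap.toMatrix_comp, LinearEquiv.comp_symm, LinearMap.toMatrix_id]
  have h1 : (TensorProduct.congr γ.1 γ.2).toLinearMap =
      TensorProduct.map γ.1.toLinearMap γ.2.toLinearMap := rfl
  have h2 : (TensorProduct.congr γ.1 γ.2).symm.toLinearMap =
      TensorProduct.map γ.1.symm.toLinearMap γ.2.symm.toLinearMap := rfl
  rw [hinv, hinv, tensorConjAction, h1, h2, LinearMap.toMatrix_comp _ (bV.tensorProduct bW),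
    LinearMap.toMatrix_comp _ (bV.tensorProduct bW), TensorProduct.toMatrix_map,
    TensorProduct.toMatrix_map, Matrix.mul_assoc]

theorem finrank_invariantPolynomials [CharZero K] (hV : Module.finrank K V = 2)
    (hW : Module.finrank K W = 2) (n : ℕ) :
    Module.finrank K (invariantPolynomials K (tensorConjAction K V W) n) =
      Module.finrank K
        ↥(MvPolynomial.homogeneousSubmodule ((Fin 2 × Fin 2) × (Fin 2 × Fin 2)) K n ⊓
          (LinearMap.ker (leftConj !![0, 1; 0, 0]) ⊓ LinearMap.ker (leftConj !![0, 0; 1, 0])) ⊓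
          (LinearMap.ker (rightConj !![0, 1; 0, 0]) ⊓
            LinearMap.ker (rightConj !![0, 0; 1, 0]))) := by
  have : FiniteDimensional K V := Module.finite_of_finrank_pos (by omega)
  have : FiniteDimensional K W := Module.finite_of_finrank_pos (by omega)
  let bV := Module.finBasisOfFinrankEq K V hV
  let bW := Module.finBasisOfFinrankEq K W hW
  let b := bV.tensorProduct bW
  let c := (Matrix.stdBasis K (Fin 2 × Fin 2) (Fin 2 × Fin 2)).map (LinearMap.toMatrix b b).symm
  have hc (φ) (q : (Fin 2 × Fin 2) × (Fin 2 × Fin 2)) :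
      c.repr φ q = LinearMap.toMatrix b b φ q.1 q.2 := by
    rfl
  let E : MvPolynomial ((Fin 2 × Fin 2) × (Fin 2 × Fin 2)) K →ₗ[K]
      ((TensorProduct K V W →ₗ[K] TensorProduct K V W) → K) :=
    LinearMap.pi fun φ => (matrixEval (LinearMap.toMatrix b b φ)).toLinearMap
  have hE (p φ) : E p φ = matrixEval (LinearMap.toMatrix b b φ) p := rfl
  have hinj : Function.Injective E := by
    rw [injective_iff_map_eq_zero]
    refine fun p hp => matrixEval_eq_zero_iff.1 fun u => ?_
    rw [← LinearMap.toMatrix_toLin b b u, ← hE, hp, Pi.zero_apply]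
  have hinv (p : MvPolynomial ((Fin 2 × Fin 2) × (Fin 2 × Fin 2)) K) :
      (∀ γ φ, E p (tensorConjAction K V W γ φ) = E p φ) ↔
        p ∈ (LinearMap.ker (leftConj !![0, 1; 0, 0]) ⊓ LinearMap.ker (leftConj !![0, 0; 1, 0])) ⊓
          (LinearMap.ker (rightConj !![0, 1; 0, 0]) ⊓
            LinearMap.ker (rightConj !![0, 0; 1, 0])) := by
    rw [matrixEval_kronecker_conj_iff]
    simp only [hE, b, toMatrix_tensorConjAction]
    refine ⟨fun H g h hg hh u => ?_, fun H γ φ => H _ _ ?_ ?_ _⟩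
    · have := H (Matrix.toLinearEquiv bV g hg.isUnit, Matrix.toLinearEquiv bW h hh.isUnit)
        (Matrix.toLin b b u)
      have ht {M : Type} [AddCommGroup M] [Module K M] (b : Module.Basis (Fin 2) K M)
          (A : Matrix (Fin 2) (Fin 2) K) (hA : IsUnit A.det) :
          LinearMap.toMatrix b b (Matrix.toLinearEquiv b A hA).toLinearMap = A :=
        LinearMap.toMatrix_toLin b b A
      rwa [ht, ht, LinearMap.toMatrix_toLin] at this
    · exact (LinearEquiv.isUnit_det γ.1 bV bV).ne_zero
    · exact (LinearEquiv.isUnit_det γ.2 bW bW).ne_zero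
  have hmap : invariantPolynomials K (tensorConjAction K V W) n = Submodule.map E
      (MvPolynomial.homogeneousSubmodule ((Fin 2 × Fin 2) × (Fin 2 × Fin 2)) K n ⊓
        (LinearMap.ker (leftConj !![0, 1; 0, 0]) ⊓ LinearMap.ker (leftConj !![0, 0; 1, 0])) ⊓
        (LinearMap.ker (rightConj !![0, 1; 0, 0]) ⊓
          LinearMap.ker (rightConj !![0, 0; 1, 0]))) := by
    ext F
    have hF : F ∈ invariantPolynomials K (tensorConjAction K V W) n ↔
      (∃ m : MultilinearMap K (fun _ : Fin n => TensorProduct K V W →ₗ[K] TensorProduct K V W) K,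
        ∀ u, F u = m fun _ => u) ∧ ∀ γ u, F (tensorConjAction K V W γ u) = F u := Iff.rfl
    rw [hF, exists_multilinear_iff_exists_homogeneous c, Submodule.mem_map]
    simp only [hc]
    constructor
    · rintro ⟨⟨p, hp, hpF⟩, hi⟩
      obtain rfl : E p = F := funext fun u => (hpF u).symm
      exact ⟨p, by rw [inf_assoc]; exact ⟨hp, (hinv p).1 hi⟩, rfl⟩
    · rintro ⟨p, hp, rfl⟩
      rw [inf_assoc] at hp
      exact ⟨⟨p, hp.1, fun u => rfl⟩, (hinv p).2 hp.2⟩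
  rw [hmap]
  exact (Submodule.equivMapOfInjective E hinj _).finrank_eq.symm

end TensorInvariants

/-- For `dim V = dim W = 2`, the Hilbert series `F(x) = Σₙ dim (K[End(V⊗W)]^Γ)ₙ xⁿ` equals
`(1 − x² − x³ + 2x⁴ + 2x⁵ + 2x⁶ − x⁷ − x⁸ + x¹⁰)/((1−x)(1−x²)⁴(1−x³)³(1−x⁴)²)`;
stated by multiplying both sides with the denominator, which is invertible in `ℤ[[x]]`. -/
theorem stmt1 (K : Type) [Field K] [CharZero K] (V W : Type) [AddCommGroup V] [Module K V]
    [AddCommGroup W] [Module K W]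
    (hV : Module.finrank K V = 2) (hW : Module.finrank K W = 2) :
    (PowerSeries.mk fun n =>
        (Module.finrank K (invariantPolynomials K (tensorConjAction K V W) n) : ℤ)) *
      ((1 - X) * (1 - X ^ 2) ^ 4 * (1 - X ^ 3) ^ 3 * (1 - X ^ 4) ^ 2) =
    1 - X ^ 2 - X ^ 3 + 2 * X ^ 4 + 2 * X ^ 5 + 2 * X ^ 6 - X ^ 7 - X ^ 8 + X ^ 10 := by
  simp only [finrank_invariantPolynomials hV hW, finrank_conj_invariants]
  exact monomialCount_endWeight_series
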